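/- Let Γ be a non-elementary discrete purely hyperbolic subgroup of SL(2,ℝ). Then the Hausdorff dimension of the set {x ∈ ℝ : [x:1] is a conical limit point of Γ} equals the Hausdorff dimension of the set {x ∈ ℝ : [x:1] is a uniform conical limit point of Γ} (both taken as subsets of ℝ with its standard metric). -/

import Mathlib

open scoped MatrixGroups LinearAlgebra.Projectivization UpperHalfPlane Pointwise
open Matrix

noncomputable section

/-- The topology on `SL(2, ℝ)` as a subspace of the space of `2 × 2` real matrices. -/
instance : TopologicalSpace SL(2, ℝ) :=
  inferInstanceAs (TopologicalSpace { A : Matrix (Fin 2) (Fin 2) ℝ // A.det = 1 })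

/-- The real projective line. -/
abbrev RP1 : Type := ℙ ℝ (Fin 2 → ℝ)

instance : TopologicalSpace RP1 :=
  inferInstanceAs (TopologicalSpace (Quotient (projectivizationSetoid ℝ (Fin 2 → ℝ))))

/-- The action of `SL(2, ℝ)` on the real projective line, via its linear action on `ℝ²`. -/
def sl2Act (g : SL(2, ℝ)) (p : RP1) : RP1 :=
  Projectivization.map (Matrix.SpecialLinearGroup.toLin' g).toLinearMap
    (Matrix.SpecialLinearGroup.toLin' g).injective p

/-- The point `[x : 1]` of the real projective line. -/
def projPt (x : ℝ) : RP1 :=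
  Projectivization.mk ℝ ![x, 1] (by
    intro h
    have := congrFun h 1
    simp at this)

/-- The point `∞ = [1 : 0]` of the real projective line. -/
def projInf : RP1 :=
  Projectivization.mk ℝ ![1, 0] (by
    intro h
    have := congrFun h 0
    simp at this)

/-- The ray in the upper half-plane associated to a point of `ℝP¹`:
`ray [x:1] = {x + i t : 0 < t ≤ 1}` and `ray ∞ = {i t : t ≥ 1}`. -/
def ray (p : RP1) : Set ℍ :=
  if p.rep 1 = 0 then {z : ℍ | z.re = 0 ∧ 1 ≤ z.im}
  else {z : ℍ | z.re = p.rep 0 / p.rep 1 ∧ z.im ≤ 1}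

/-- An element of `SL(2, ℝ)` is hyperbolic if the absolute value of its trace exceeds `2`. -/
def IsHyperbolic (g : SL(2, ℝ)) : Prop :=
  2 < |Matrix.trace (g : Matrix (Fin 2) (Fin 2) ℝ)|

/-- A subgroup of `SL(2, ℝ)` is purely hyperbolic if all of its non-identity elements
are hyperbolic. -/
def PurelyHyperbolic (Γ : Subgroup SL(2, ℝ)) : Prop :=
  ∀ g ∈ Γ, g ≠ 1 → IsHyperbolic g

/-- A subgroup of `SL(2, ℝ)` is non-elementary if it is not virtually abelian, i.e. it has
no abelian subgroup of finite index. -/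
def IsNonElementary (Γ : Subgroup SL(2, ℝ)) : Prop :=
  ¬ ∃ H : Subgroup Γ, H.FiniteIndex ∧ ∀ a ∈ H, ∀ b ∈ H, a * b = b * a

/-- `p ∈ ℝP¹` is a conical limit point of `Γ'` if some compact subset of `ℍ` has infinitely
many `Γ'`-translates meeting the ray ending at `p`. -/
def IsConicalLimitPoint (Γ' : Subgroup SL(2, ℝ)) (p : RP1) : Prop :=
  ∃ K : Set ℍ, IsCompact K ∧ ∃ γ : ℕ → SL(2, ℝ), Function.Injective γ ∧
    (∀ k, γ k ∈ Γ') ∧ ∀ k, (γ k • K ∩ ray p).Nonempty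

/-- `p ∈ ℝP¹` is a uniform conical limit point of `Γ'` if the ray ending at `p` is covered by
the translates of a single compact subset of `ℍ` by an injective sequence in `Γ'`. -/
def IsUniformConicalLimitPoint (Γ' : Subgroup SL(2, ℝ)) (p : RP1) : Prop :=
  ∃ K : Set ℍ, IsCompact K ∧ ∃ γ : ℕ → SL(2, ℝ), Function.Injective γ ∧
    (∀ k, γ k ∈ Γ') ∧ ray p ⊆ ⋃ k, γ k • K

/-- The limit set of a subgroup of `SL(2, ℝ)`: the closure in `ℝP¹` of the set of fixed
points of hyperbolic elements of the subgroup. -/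
def limitSet (Γ' : Subgroup SL(2, ℝ)) : Set RP1 :=
  closure {p : RP1 | ∃ g ∈ Γ', IsHyperbolic g ∧ sl2Act g p = p}

/-! ### The Möbius action on the real line -/

/-- The denominator `c x + d` of the Möbius transformation of `g` at the real point `x`. -/
def realDenom (g : SL(2, ℝ)) (x : ℝ) : ℝ := g 1 0 * x + g 1 1

/-- The Möbius transformation of `g` on the real line, with junk value `0` at the pole. -/
def realMoebius (g : SL(2, ℝ)) (x : ℝ) : ℝ := (g 0 0 * x + g 0 1) / realDenom g x

lemma sl2_det_eq (g : SL(2, ℝ)) : g 0 0 * g 1 1 - g 0 1 * g 1 0 = 1 := by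
  rw [← Matrix.det_fin_two]; exact g.2

lemma sl2_mul_apply (g h : SL(2, ℝ)) (i j : Fin 2) :
    (g * h) i j = g i 0 * h 0 j + g i 1 * h 1 j := by
  simp [Matrix.mul_apply, Fin.sum_univ_two]

lemma realDenom_one (x : ℝ) : realDenom 1 x = 1 := by simp [realDenom]

lemma realMoebius_one (x : ℝ) : realMoebius 1 x = x := by simp [realMoebius, realDenom_one]

lemma realMoebius_mul_realDenom (g : SL(2, ℝ)) {x : ℝ} (hx : realDenom g x ≠ 0) :
    realMoebius g x * realDenom g x = g 0 0 * x + g 0 1 :=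
  div_mul_cancel₀ _ hx

lemma realDenom_mul (g h : SL(2, ℝ)) {x : ℝ} (hx : realDenom h x ≠ 0) :
    realDenom (g * h) x = realDenom g (realMoebius h x) * realDenom h x := by
  have h1 := realMoebius_mul_realDenom h hx
  have h2 : realDenom g (realMoebius h x) = g 1 0 * realMoebius h x + g 1 1 := rfl
  have h3 : realDenom h x = h 1 0 * x + h 1 1 := rfl
  have h4 : realDenom (g * h) x = (g * h) 1 0 * x + (g * h) 1 1 := rfl
  rw [sl2_mul_apply, sl2_mul_apply] at h4
  rw [h4, h2]
  linear_combination -(g 1 0) * h1 - (g 1 1) * h3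

lemma realMoebius_mul (g h : SL(2, ℝ)) {x : ℝ} (hx : realDenom h x ≠ 0) :
    realMoebius (g * h) x = realMoebius g (realMoebius h x) := by
  have h1 := realMoebius_mul_realDenom h hx
  have h3 : realDenom h x = h 1 0 * x + h 1 1 := rfl
  have h4 : realMoebius (g * h) x = ((g * h) 0 0 * x + (g * h) 0 1) / realDenom (g * h) x := rfl
  have h5 : realMoebius g (realMoebius h x) =
    (g 0 0 * realMoebius h x + g 0 1) / realDenom g (realMoebius h x) := rfl
  rw [h4, realDenom_mul g h hx, h5,
    ← mul_div_mul_right (g 0 0 * realMoebius h x + g 0 1) _ hx, sl2_mul_apply, sl2_mul_apply]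
  congr 1
  linear_combination -(g 0 0) * h1 - (g 0 1) * h3

lemma realMoebius_sub (g : SL(2, ℝ)) {x y : ℝ} (hx : realDenom g x ≠ 0)
    (hy : realDenom g y ≠ 0) :
    realMoebius g x - realMoebius g y = (x - y) / (realDenom g x * realDenom g y) := by
  rw [realMoebius, realMoebius, div_sub_div _ _ hx hy]
  congr 1
  simp only [realDenom]
  linear_combination (x - y) * sl2_det_eq g

lemma realMoebius_continuousOn (g : SL(2, ℝ)) {s : Set ℝ} (hs : ∀ x ∈ s, realDenom g x ≠ 0) :
    ContinuousOn (realMoebius g) s := by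
  unfold realMoebius
  refine ContinuousOn.div (by fun_prop) ?_ hs
  unfold realDenom
  fun_prop

/-- The logarithmic derivative of the denominator obeys a cocycle relation. -/
lemma entry_div_realDenom_mul (g h : SL(2, ℝ)) {x : ℝ} (hx : realDenom h x ≠ 0)
    (hg : realDenom g (realMoebius h x) ≠ 0) :
    (g * h) 1 0 / realDenom (g * h) x =
      g 1 0 / realDenom g (realMoebius h x) / realDenom h x ^ 2 + h 1 0 / realDenom h x := by
  rw [realDenom_mul g h hx, sl2_mul_apply]
  have h1 := realMoebius_mul_realDenom h hx
  have h2 : realDenom g (realMoebius h x) = g 1 0 * realMoebius h x + g 1 1 := rfl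
  have h3 : realDenom h x = h 1 0 * x + h 1 1 := rfl
  have h4 := sl2_det_eq h
  set u := realDenom g (realMoebius h x)
  set v := realDenom h x
  set y := realMoebius h x
  have h5 : h 0 0 * v = 1 + y * v * h 1 0 := by
    rw [h1, h3]; linear_combination h4
  field_simp
  rw [h2]
  linear_combination (g 1 0) * h5

/-! ### Cantor systems -/

/-- A finite family of elements of `SL(2, ℝ)` which map `I` into itself, contract it by factors
between `1 / L` and `1 / 2`, and have `δ`-separated images. -/
structure IsCantorSystem (I : Set ℝ) (L δ : ℝ) {N : ℕ} (φ : Fin N → SL(2, ℝ)) : Prop where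
  mapsTo : ∀ i, ∀ x ∈ I, realMoebius (φ i) x ∈ I
  two_le : ∀ i, ∀ x ∈ I, 2 ≤ realDenom (φ i) x ^ 2
  le : ∀ i, ∀ x ∈ I, realDenom (φ i) x ^ 2 ≤ L
  sep : ∀ i k, i ≠ k → ∀ x ∈ I, ∀ y ∈ I, δ ≤ |realMoebius (φ i) x - realMoebius (φ k) y|

/-- The product `φ (ω 0) * ⋯ * φ (ω (n - 1))`. -/
def codeWord {N : ℕ} (φ : Fin N → SL(2, ℝ)) (ω : ℕ → Fin N) : ℕ → SL(2, ℝ)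
  | 0 => 1
  | n + 1 => codeWord φ ω n * φ (ω n)

lemma codeWord_congr {N : ℕ} (φ : Fin N → SL(2, ℝ)) {ω ω' : ℕ → Fin N} {n : ℕ}
    (h : ∀ i < n, ω i = ω' i) : codeWord φ ω n = codeWord φ ω' n := by
  induction n with
  | zero => rfl
  | succ n ih => rw [codeWord, codeWord, ih fun i hi => h i (by omega), h n (by omega)]

lemma codeWord_mem {N : ℕ} {φ : Fin N → SL(2, ℝ)} {Γ : Subgroup SL(2, ℝ)} (hφ : ∀ i, φ i ∈ Γ)
    (ω : ℕ → Fin N) (n : ℕ) : codeWord φ ω n ∈ Γ := by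
  induction n with
  | zero => exact Γ.one_mem
  | succ n ih => exact Γ.mul_mem ih (hφ _)

namespace IsCantorSystem

variable {I : Set ℝ} {L δ : ℝ} {N : ℕ} {φ : Fin N → SL(2, ℝ)}

lemma denom_ne_zero (h : IsCantorSystem I L δ φ) (i : Fin N) {x : ℝ} (hx : x ∈ I) :
    realDenom (φ i) x ≠ 0 := by
  intro h0
  have := h.two_le i x hx
  rw [h0] at this
  norm_num at this

lemma codeWord_two_pow_le (h : IsCantorSystem I L δ φ) (ω : ℕ → Fin N) (n : ℕ) :
    ∀ x ∈ I, 2 ^ n ≤ realDenom (codeWord φ ω n) x ^ 2 := by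
  induction n with
  | zero => intro x _; simp [codeWord, realDenom_one]
  | succ n ih =>
    intro x hx
    rw [codeWord, realDenom_mul _ _ (h.denom_ne_zero _ hx), mul_pow, pow_succ]
    exact mul_le_mul (ih _ (h.mapsTo _ x hx)) (h.two_le _ x hx) (by norm_num) (sq_nonneg _)

lemma codeWord_le (h : IsCantorSystem I L δ φ) (ω : ℕ → Fin N) (n : ℕ) :
    ∀ x ∈ I, realDenom (codeWord φ ω n) x ^ 2 ≤ L ^ n := by
  induction n with
  | zero => intro x _; simp [codeWord, realDenom_one]
  | succ n ih =>
    intro x hx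
    rw [codeWord, realDenom_mul _ _ (h.denom_ne_zero _ hx), mul_pow, pow_succ]
    have := ih _ (h.mapsTo (ω n) x hx)
    exact mul_le_mul this (h.le _ x hx) (sq_nonneg _) ((sq_nonneg _).trans this)

lemma codeWord_denom_ne_zero (h : IsCantorSystem I L δ φ) (ω : ℕ → Fin N) (n : ℕ) {x : ℝ}
    (hx : x ∈ I) : realDenom (codeWord φ ω n) x ≠ 0 := by
  intro h0
  have := h.codeWord_two_pow_le ω n x hx
  rw [h0] at this
  have h2 : (0 : ℝ) < 2 ^ n := by positivity
  norm_num at this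
  linarith

lemma codeWord_succ_apply (h : IsCantorSystem I L δ φ) (ω : ℕ → Fin N) (n : ℕ) {x : ℝ}
    (hx : x ∈ I) : realMoebius (codeWord φ ω (n + 1)) x =
      realMoebius (codeWord φ ω n) (realMoebius (φ (ω n)) x) :=
  realMoebius_mul _ _ (h.denom_ne_zero _ hx)

lemma codeWord_injOn (h : IsCantorSystem I L δ φ) (ω : ℕ → Fin N) (n : ℕ) :
    Set.InjOn (realMoebius (codeWord φ ω n)) I := by
  intro x hx y hy hxy
  have h1 := h.codeWord_denom_ne_zero ω n hx
  have h2 := h.codeWord_denom_ne_zero ω n hy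
  have := realMoebius_sub _ h1 h2
  rw [hxy, sub_self, eq_comm, div_eq_zero_iff, or_iff_left (mul_ne_zero h1 h2)] at this
  linarith

/-- Every code `ω` has a limit point `ξ 0`, whose renormalizations along `ω` stay in `I`. -/
lemma exists_orbit (h : IsCantorSystem I L δ φ) (hI : IsCompact I) (hne : I.Nonempty)
    (ω : ℕ → Fin N) :
    ∃ ξ : ℕ → ℝ, (∀ n, ξ n ∈ I) ∧ ∀ n, realMoebius (codeWord φ ω n) (ξ n) = ξ 0 := by
  have hc : ∀ n, IsCompact (realMoebius (codeWord φ ω n) '' I) := fun n =>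
    hI.image_of_continuousOn
      (realMoebius_continuousOn _ fun x hx => h.codeWord_denom_ne_zero ω n hx)
  obtain ⟨x, hx⟩ := IsCompact.nonempty_iInter_of_sequence_nonempty_isCompact_isClosed
    (fun n => realMoebius (codeWord φ ω n) '' I)
    (by
      rintro n _ ⟨x, hx, rfl⟩
      exact ⟨_, h.mapsTo _ x hx, (h.codeWord_succ_apply ω n hx).symm⟩)
    (fun n => hne.image _) (hc 0) (fun n => (hc n).isClosed)
  rw [Set.mem_iInter] at hx
  choose ξ hξ hξx using hx
  have h0 : ξ 0 = x := by rw [← hξx 0, codeWord, realMoebius_one]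
  exact ⟨ξ, hξ, fun n => (hξx n).trans h0.symm⟩

lemma orbit_step (h : IsCantorSystem I L δ φ) {ω : ℕ → Fin N} {ξ : ℕ → ℝ} (hξ : ∀ n, ξ n ∈ I)
    (hω : ∀ n, realMoebius (codeWord φ ω n) (ξ n) = ξ 0) (n : ℕ) :
    realMoebius (φ (ω n)) (ξ (n + 1)) = ξ n := by
  refine h.codeWord_injOn ω n (h.mapsTo _ _ (hξ _)) (hξ n) ?_
  rw [← h.codeWord_succ_apply ω n (hξ _), hω, hω]

/-- Limit points whose codes first differ at place `n` are at distance at least `δ / L ^ n`. -/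
lemma div_pow_le_abs_sub (h : IsCantorSystem I L δ φ) {ω ω' : ℕ → Fin N}
    {ξ ξ' : ℕ → ℝ}
    (hξ : ∀ n, ξ n ∈ I) (hω : ∀ n, realMoebius (codeWord φ ω n) (ξ n) = ξ 0)
    (hξ' : ∀ n, ξ' n ∈ I) (hω' : ∀ n, realMoebius (codeWord φ ω' n) (ξ' n) = ξ' 0)
    {n : ℕ} (heq : ∀ i < n, ω i = ω' i) (hne : ω n ≠ ω' n) :
    δ / L ^ n ≤ |ξ 0 - ξ' 0| := by
  have hw := codeWord_congr φ heq
  have h1 := h.codeWord_denom_ne_zero ω n (hξ n)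
  have h2 := h.codeWord_denom_ne_zero ω n (hξ' n)
  have hsep : δ ≤ |ξ n - ξ' n| := by
    rw [← h.orbit_step hξ hω n, ← h.orbit_step hξ' hω' n]
    exact h.sep _ _ hne _ (hξ _) _ (hξ' _)
  have hle : |realDenom (codeWord φ ω n) (ξ n) * realDenom (codeWord φ ω n) (ξ' n)| ≤ L ^ n := by
    have ha := h.codeWord_le ω n _ (hξ n)
    have hb := h.codeWord_le ω n _ (hξ' n)
    rw [abs_le]
    constructor <;> nlinarith [sq_nonneg (realDenom (codeWord φ ω n) (ξ n) -
      realDenom (codeWord φ ω n) (ξ' n)), sq_nonneg (realDenom (codeWord φ ω n) (ξ n) +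
      realDenom (codeWord φ ω n) (ξ' n))]
  rw [← hω n, ← hω' n, ← hw, realMoebius_sub _ h1 h2, abs_div]
  exact div_le_div₀ (abs_nonneg _) hsep (abs_pos.2 (mul_ne_zero h1 h2)) hle

end IsCantorSystem

/-! ### Rays and limit points -/

lemma mem_ray_projPt {x : ℝ} {z : ℍ} : z ∈ ray (projPt x) ↔ z.re = x ∧ z.im ≤ 1 := by
  obtain ⟨a, ha⟩ := Projectivization.exists_smul_eq_mk_rep ℝ (![x, 1] : Fin 2 → ℝ)
    (fun h => by simpa using congrFun h 1)
  have h0 : (projPt x).rep 0 = a * x := by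
    simpa [Units.smul_def, projPt] using (congrFun ha 0).symm
  have h1 : (projPt x).rep 1 = a := by
    simpa [Units.smul_def, projPt] using (congrFun ha 1).symm
  have ha0 : (a : ℝ) ≠ 0 := a.ne_zero
  rw [ray, h0, h1, if_neg ha0, mul_div_cancel_left₀ _ ha0]
  rfl

/-- A compact box in the upper half-plane. -/
def hyperbolicBox (b B : ℝ) : Set ℍ := {z | |z.re| ≤ B ∧ b ≤ z.im ∧ z.im ≤ B}

lemma isCompact_hyperbolicBox {b : ℝ} (hb : 0 < b) (B : ℝ) : IsCompact (hyperbolicBox b B) := by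
  rw [UpperHalfPlane.isOpenEmbedding_coe.isEmbedding.isCompact_iff]
  have : (UpperHalfPlane.coe '' hyperbolicBox b B) = Set.Icc (-B) B ×ℂ Set.Icc b B := by
    ext z
    constructor
    · rintro ⟨w, ⟨h1, h2⟩, rfl⟩
      exact ⟨abs_le.1 h1, h2⟩
    · rintro ⟨h1, h2⟩
      exact ⟨⟨z, hb.trans_le h2.1⟩, ⟨abs_le.2 h1, h2⟩, rfl⟩
  rw [this]
  exact isCompact_Icc.reProdIm isCompact_Icc

lemma coe_sl2_smul (g : SL(2, ℝ)) (z : ℍ) :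
    ((g • z : ℍ) : ℂ) = ((g 0 0 : ℂ) * z + (g 0 1 : ℂ)) / ((g 1 0 : ℂ) * z + (g 1 1 : ℂ)) :=
  UpperHalfPlane.coe_specialLinearGroup_apply g z

/-- The vertical line over `g ξ`, pulled back by `g`: the point at height `t` is at bounded distance
from `ξ + i` if `t * (c ξ + d) ^ 2` and `c / (c ξ + d)` are bounded. -/
lemma mem_smul_hyperbolicBox {g : SL(2, ℝ)} {ξ τ A B b C : ℝ} {z : ℍ} (hm : realDenom g ξ ≠ 0)
    (hz : z.re = realMoebius g ξ) (hτ : z.im * realDenom g ξ ^ 2 = τ) (hτ1 : 1 ≤ τ) (hτB : τ ≤ B)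
    (hκ : |g 1 0 / realDenom g ξ| ≤ A) (hξ : |ξ| ≤ C)
    (hb : b * (1 + (B * A) ^ 2) ≤ 1) :
    z ∈ g • hyperbolicBox b (C + B + B ^ 2 * A) := by
  set m := realDenom g ξ with hmdef
  set κ := g 1 0 / m with hκdef
  have hden : 0 < 1 + (τ * κ) ^ 2 := by positivity
  have hτκ : (τ * κ) ^ 2 ≤ (B * A) ^ 2 := by
    rw [sq_le_sq, abs_mul, abs_mul]
    exact mul_le_mul (abs_le_abs_of_nonneg (by linarith) hτB) (hκ.trans (le_abs_self A))
      (abs_nonneg _) (abs_nonneg _)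
  set si := τ / (1 + (τ * κ) ^ 2) with hsi
  set sr := -(τ * κ * si) with hsr
  have hsi0 : 0 < si := by positivity
  have hsi1 : si ≤ τ := div_le_self (by linarith) (by nlinarith [sq_nonneg (τ * κ)])
  have hsieq : si = τ * (1 + κ * sr) := by
    rw [hsr, hsi]; field_simp; ring
  have hA : 0 ≤ A := (abs_nonneg _).trans hκ
  have hsrle : |sr| ≤ B ^ 2 * A := by
    rw [hsr, abs_neg, abs_mul, abs_mul, abs_of_pos hsi0, abs_of_pos (by linarith : 0 < τ)]
    have hB : 0 ≤ B := by linarith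
    calc τ * |κ| * si ≤ B * A * B := by gcongr; linarith
      _ = B ^ 2 * A := by ring
  refine ⟨⟨⟨ξ + sr, si⟩, hsi0⟩, ⟨?_, ?_, ?_⟩, ?_⟩
  · change |ξ + sr| ≤ _
    have := abs_add_le ξ sr
    linarith
  · change b ≤ si
    rw [hsi, le_div_iff₀ hden]
    nlinarith
  · change si ≤ _
    have : 0 ≤ C := (abs_nonneg _).trans hξ
    have : 0 ≤ B ^ 2 * A := by positivity
    linarith
  · apply UpperHalfPlane.ext
    change ((g • (⟨⟨ξ + sr, si⟩, hsi0⟩ : ℍ) : ℍ) : ℂ) = _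
    have hc : g 1 0 = κ * m := by rw [hκdef, div_mul_cancel₀ _ hm]
    have hd : g 1 1 = m - κ * m * ξ := by rw [← hc, hmdef, realDenom]; ring
    have hx := realMoebius_mul_realDenom g hm
    rw [← hz, ← hmdef] at hx
    have hdet := sl2_det_eq g
    have ha : g 0 0 * m = 1 + z.re * (κ * m) * m := by
      have : m = g 1 0 * ξ + g 1 1 := hmdef
      rw [← hc]
      linear_combination hdet + g 0 0 * this - g 1 0 * hx
    have ha' : g 0 0 = m⁻¹ + z.re * (κ * m) := by
      field_simp; linear_combination ha
    have him : z.im = τ * m⁻¹ ^ 2 := by rw [← hτ]; field_simp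
    rw [coe_sl2_smul, div_eq_iff]
    · apply Complex.ext
      · simp
        rw [hc, hd, him]
        have hb' : g 0 1 = z.re * m - g 0 0 * ξ := by linear_combination -hx
        rw [hb', ha']
        field_simp
        rw [hsr]; ring
      · simp
        rw [hc, hd, him, ha']
        field_simp
        linear_combination hsieq
    · intro h0
      have h1 := congrArg Complex.im h0
      have h2 := congrArg Complex.re h0
      simp [hsi0.ne'] at h1
      simp [h1] at h2
      apply hm
      rw [hmdef, realDenom, h1, h2]; ring

namespace IsCantorSystem

variable {I : Set ℝ} {L δ : ℝ} {N : ℕ} {φ : Fin N → SL(2, ℝ)}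

lemma codeWord_injective (h : IsCantorSystem I L δ φ) (hne : I.Nonempty) (ω : ℕ → Fin N) :
    Function.Injective (codeWord φ ω) := by
  have key : ∀ (n k : ℕ), ∀ x ∈ I, ∃ y ∈ I,
      2 ^ k * realDenom (codeWord φ ω n) y ^ 2 ≤ realDenom (codeWord φ ω (n + k)) x ^ 2 ∧
        realMoebius (codeWord φ ω n) y = realMoebius (codeWord φ ω (n + k)) x := by
    intro n k
    induction k with
    | zero => intro x hx; exact ⟨x, hx, by simp, rfl⟩
    | succ k ih =>
      intro x hx
      obtain ⟨y, hy, hle, hy'⟩ := ih _ (h.mapsTo (ω (n + k)) x hx)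
      refine ⟨y, hy, ?_, ?_⟩
      · rw [← add_assoc, codeWord, realDenom_mul _ _ (h.denom_ne_zero _ hx), mul_pow, pow_succ]
        have := h.two_le (ω (n + k)) x hx
        calc _ = 2 ^ k * realDenom (codeWord φ ω n) y ^ 2 * 2 := by ring
          _ ≤ _ := mul_le_mul hle this (by norm_num) (sq_nonneg _)
      · rw [hy', ← add_assoc, h.codeWord_succ_apply ω _ hx]
  have lt_ne : ∀ n k : ℕ, codeWord φ ω n ≠ codeWord φ ω (n + (k + 1)) := by
    intro n k heq
    obtain ⟨x, hx⟩ := hne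
    obtain ⟨y, hy, hle, hy'⟩ := key n (k + 1) x hx
    rw [← heq] at hle hy'
    rw [h.codeWord_injOn ω n hy hx hy'] at hle
    have h1 : 0 < realDenom (codeWord φ ω n) x ^ 2 :=
      pow_pos two_pos n |>.trans_le (h.codeWord_two_pow_le ω n x hx)
    have h2 : (2 : ℝ) ≤ 2 ^ (k + 1) := by
      rw [pow_succ]; nlinarith [one_le_pow₀ (n := k) (one_le_two : (1 : ℝ) ≤ 2)]
    nlinarith
  intro n n' hnn
  rcases lt_trichotomy n n' with hlt | heq | hlt
  · obtain ⟨k, rfl⟩ := Nat.exists_eq_add_of_lt hlt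
    exact (lt_ne n k hnn).elim
  · exact heq
  · obtain ⟨k, rfl⟩ := Nat.exists_eq_add_of_lt hlt
    exact (lt_ne n' k hnn.symm).elim

lemma abs_entry_div_le (h : IsCantorSystem I L δ φ) (ω : ℕ → Fin N) {A : ℝ}
    (hA : ∀ i, ∀ x ∈ I, |(φ i) 1 0 / realDenom (φ i) x| ≤ A) (hA0 : 0 ≤ A) (n : ℕ) :
    ∀ x ∈ I, |(codeWord φ ω n) 1 0 / realDenom (codeWord φ ω n) x| ≤ 2 * A := by
  induction n with
  | zero => intro x _; simpa [codeWord] using hA0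
  | succ n ih =>
    intro x hx
    have hmem := h.mapsTo (ω n) x hx
    rw [codeWord, entry_div_realDenom_mul _ _ (h.denom_ne_zero _ hx)
      (h.codeWord_denom_ne_zero ω n hmem)]
    refine (abs_add_le _ _).trans ?_
    rw [abs_div _ (realDenom (φ (ω n)) x ^ 2), abs_of_nonneg (sq_nonneg (realDenom (φ (ω n)) x))]
    have h1 : |(codeWord φ ω n) 1 0 /
        realDenom (codeWord φ ω n) (realMoebius (φ (ω n)) x)| / realDenom (φ (ω n)) x ^ 2 ≤
        2 * A / 2 :=
      div_le_div₀ (by linarith) (ih _ hmem) (by norm_num) (h.two_le _ x hx)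
    linarith [hA (ω n) x hx]

lemma isUniformConicalLimitPoint (h : IsCantorSystem I L δ φ) (hI : IsCompact I)
    (hne : I.Nonempty) {Γ : Subgroup SL(2, ℝ)} (hφ : ∀ i, φ i ∈ Γ) {ω : ℕ → Fin N} {ξ : ℕ → ℝ}
    (hξ : ∀ n, ξ n ∈ I) (hω : ∀ n, realMoebius (codeWord φ ω n) (ξ n) = ξ 0) :
    IsUniformConicalLimitPoint Γ (projPt (ξ 0)) := by
  obtain ⟨C, hC⟩ := hI.isBounded.exists_norm_le
  have hL : 2 ≤ L := by
    obtain ⟨x, hx⟩ := hne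
    exact (h.two_le (ω 0) x hx).trans (h.le (ω 0) x hx)
  obtain ⟨A, hA0, hA⟩ : ∃ A, 0 ≤ A ∧ ∀ i, ∀ x ∈ I, |(φ i) 1 0 / realDenom (φ i) x| ≤ A := by
    have : ∀ i, ∀ x ∈ I, |(φ i) 1 0 / realDenom (φ i) x| ≤ |(φ i) 1 0| := by
      intro i x hx
      rw [abs_div]
      refine div_le_self (abs_nonneg _) ?_
      have := h.two_le i x hx
      rw [← sq_abs] at this
      nlinarith [abs_nonneg (realDenom (φ i) x)]
    refine ⟨∑ i, |(φ i) 1 0|, by positivity, fun i x hx => (this i x hx).trans ?_⟩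
    exact Finset.single_le_sum (f := fun i => |(φ i) 1 0|) (fun _ _ => abs_nonneg _)
      (Finset.mem_univ i)
  set b : ℝ := (1 + (L * (2 * A)) ^ 2)⁻¹ with hb
  have hb0 : 0 < b := by positivity
  refine ⟨hyperbolicBox b (C + L + L ^ 2 * (2 * A)), isCompact_hyperbolicBox hb0 _,
    codeWord φ ω, h.codeWord_injective hne ω, codeWord_mem hφ ω, ?_⟩
  intro z hz
  obtain ⟨hzre, hzim⟩ := mem_ray_projPt.1 hz
  have hex : ∃ n, 1 ≤ z.im * realDenom (codeWord φ ω n) (ξ n) ^ 2 := by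
    obtain ⟨n, hn⟩ := pow_unbounded_of_one_lt (z.im)⁻¹ (one_lt_two)
    refine ⟨n, ?_⟩
    have h1 := h.codeWord_two_pow_le ω n _ (hξ n)
    have h2 := (hn.trans_le h1).le
    rwa [inv_le_iff_one_le_mul₀' z.im_pos] at h2
  classical
  have hn := Nat.find_spec hex
  have hmin := fun k => Nat.find_min hex (m := k)
  set n := Nat.find hex
  have hle : z.im * realDenom (codeWord φ ω n) (ξ n) ^ 2 ≤ L := by
    rcases hn0 : n with _ | k
    · rw [codeWord, realDenom_one]; linarith
    · have h1 := hmin k (by omega)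
      push Not at h1
      have h2 := h.orbit_step hξ hω k
      rw [codeWord, realDenom_mul _ _ (h.denom_ne_zero _ (hξ _)), h2, mul_pow, ← mul_assoc]
      have h3 := h.le (ω k) _ (hξ (k + 1))
      calc _ ≤ 1 * L := mul_le_mul h1.le h3 (sq_nonneg _) zero_le_one
        _ = L := one_mul L
  refine Set.mem_iUnion.2 ⟨n, mem_smul_hyperbolicBox (h.codeWord_denom_ne_zero ω n (hξ n))
    (by rw [hω, hzre]) rfl hn hle (h.abs_entry_div_le ω hA hA0 n _ (hξ n)) (hC _ (hξ n)) ?_⟩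
  rw [hb, inv_mul_cancel₀ (by positivity)]

end IsCantorSystem

/-- A set parametrized by `[0, 1]` by an inverse Hölder map of exponent `t` has dimension at
least `t`. -/
lemma le_dimH_of_inverse_holder {g : ℝ → ℝ} {t C : NNReal} (ht : 0 < t) {S : Set ℝ}
    (hS : ∀ y ∈ Set.Icc (0 : ℝ) 1, g y ∈ S)
    (hg : ∀ y ∈ Set.Icc (0 : ℝ) 1, ∀ y' ∈ Set.Icc (0 : ℝ) 1,
      |y - y'| ≤ C * |g y - g y'| ^ (t : ℝ)) : (t : ENNReal) ≤ dimH S := by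
  have hinj : Set.InjOn g (Set.Icc 0 1) := by
    intro y hy y' hy' heq
    have := hg y hy y' hy'
    rw [heq, sub_self, abs_zero, Real.zero_rpow (by exact_mod_cast ht.ne'), mul_zero] at this
    linarith [abs_nonpos_iff.1 this]
  have hleft : ∀ y ∈ Set.Icc (0 : ℝ) 1, Function.invFunOn g (Set.Icc 0 1) (g y) = y :=
    fun y hy => hinj.leftInvOn_invFunOn hy
  have hH : HolderOnWith C t (Function.invFunOn g (Set.Icc 0 1)) (g '' Set.Icc 0 1) := by
    rintro _ ⟨y, hy, rfl⟩ _ ⟨y', hy', rfl⟩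
    rw [hleft y hy, hleft y' hy', edist_dist, edist_dist, Real.dist_eq, Real.dist_eq,
      ENNReal.ofReal_rpow_of_nonneg (abs_nonneg _) t.coe_nonneg, ← ENNReal.ofReal_coe_nnreal,
      ← ENNReal.ofReal_mul C.coe_nonneg]
    exact ENNReal.ofReal_le_ofReal (hg y hy y' hy')
  have h1 := hH.dimH_image_le ht
  have h2 : Function.invFunOn g (Set.Icc 0 1) '' (g '' Set.Icc 0 1) = Set.Icc 0 1 := by
    rw [Set.image_image]
    exact (Set.image_congr hleft).trans (Set.image_id' _)
  have h3 : dimH (Set.Icc (0 : ℝ) 1) = 1 := by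
    rw [Real.dimH_of_nonempty_interior (by simp)]
    simp
  rw [h2, h3] at h1
  have h4 : dimH (g '' Set.Icc 0 1) ≤ dimH S := dimH_mono (by rintro _ ⟨y, hy, rfl⟩; exact hS y hy)
  rw [ENNReal.le_div_iff_mul_le (Or.inl (by exact_mod_cast ht.ne')) (Or.inl (by simp)),
    one_mul] at h1
  exact h1.trans h4

namespace IsCantorSystem

variable {I : Set ℝ} {L δ : ℝ} {N : ℕ} {φ : Fin N → SL(2, ℝ)}

lemma le_dimH (h : IsCantorSystem I L δ φ) (hδ : 0 < δ) (hI : IsCompact I)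
    (hne : I.Nonempty) {Γ : Subgroup SL(2, ℝ)} (hφ : ∀ i, φ i ∈ Γ) {t : NNReal} (ht : 0 < t)
    (hL : 2 ≤ L) (hN : L ^ (t : ℝ) ≤ N) :
    (t : ENNReal) ≤ dimH {x : ℝ | IsUniformConicalLimitPoint Γ (projPt x)} := by
  have hN1 : 1 < N := by
    have : 1 < L ^ (t : ℝ) := Real.one_lt_rpow (by linarith) (by exact_mod_cast ht)
    exact_mod_cast this.trans_le hN
  have : Nonempty (Fin N) := ⟨⟨0, by omega⟩⟩
  choose! ω _ hω using fun (y : ℝ) (hy : y ∈ Set.Icc (0 : ℝ) 1) => Real.ofDigits_SurjOn hN1 hy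
  choose ξ hξI hξ using h.exists_orbit hI hne
  have hinv : 0 ≤ (δ ^ (t : ℝ))⁻¹ := by positivity
  refine le_dimH_of_inverse_holder (g := fun y => ξ (ω y) 0) (C := ⟨(δ ^ (t : ℝ))⁻¹, hinv⟩) ht
    (fun y _ => h.isUniformConicalLimitPoint hI hne hφ (hξI (ω y)) (hξ (ω y))) ?_
  intro y hy y' hy'
  by_cases heq : ω y = ω y'
  · have : y = y' := by rw [← hω y hy, ← hω y' hy', heq]
    rw [this, sub_self, abs_zero]
    positivity
  classical
  have hex : ∃ n, ω y n ≠ ω y' n := Function.ne_iff.1 heq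
  have hn := Nat.find_spec hex
  have hmin : ∀ k < Nat.find hex, ω y k = ω y' k := fun k hk => by
    simpa using Nat.find_min hex hk
  set n := Nat.find hex
  have h1 := Real.abs_ofDigits_sub_ofDigits_le hmin
  rw [hω y hy, hω y' hy'] at h1
  have h2 := h.div_pow_le_abs_sub (hξI _) (hξ _) (hξI _) (hξ _) hmin hn
  have hLn : 0 < L ^ n := by positivity
  calc |y - y'| ≤ ((N : ℝ) ^ n)⁻¹ := h1
    _ ≤ ((L ^ (t : ℝ)) ^ n)⁻¹ := by gcongr
    _ = (δ ^ (t : ℝ))⁻¹ * (δ / L ^ n) ^ (t : ℝ) := by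
      rw [Real.div_rpow hδ.le hLn.le, ← Real.rpow_natCast, ← Real.rpow_natCast, ← Real.rpow_mul
        (by linarith), ← Real.rpow_mul (by linarith), mul_comm (t : ℝ)]
      field_simp
    _ ≤ _ := by
      change _ ≤ (δ ^ (t : ℝ))⁻¹ * _
      gcongr

end IsCantorSystem

/-! ### Selecting a Cantor system from a large family -/

/-- A finite set on which a symmetric reflexive relation has at most `C` neighbours of each point
contains an independent set of proportion `1 / C`. -/
lemma exists_independent_subset {α : Type*} (F : Finset α) (r : α → α → Prop)
    (hrefl : ∀ a, r a a) (hsymm : ∀ a b, r a b → r b a) {C : ℕ}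
    (hC : ∀ a ∈ F, ∀ G ⊆ F, (∀ b ∈ G, r a b) → G.card ≤ C) :
    ∃ F' ⊆ F, (∀ a ∈ F', ∀ b ∈ F', a ≠ b → ¬ r a b) ∧ F.card ≤ F'.card * C := by
  classical
  obtain ⟨F', hF', hmax⟩ := Finset.exists_max_image
    (F.powerset.filter fun G => ∀ a ∈ G, ∀ b ∈ G, a ≠ b → ¬ r a b) Finset.card
    ⟨∅, by simp⟩
  simp only [Finset.mem_filter, Finset.mem_powerset] at hF' hmax
  refine ⟨F', hF'.1, hF'.2, ?_⟩
  have hcover : F ⊆ F'.biUnion fun a => F.filter (r a) := by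
    intro b hb
    by_contra hcon
    simp only [Finset.mem_biUnion, Finset.mem_filter, not_exists, not_and] at hcon
    have hbF : b ∉ F' := fun h => hcon b h hb (hrefl b)
    have := hmax (insert b F') ⟨Finset.insert_subset hb hF'.1, by
      intro x hx y hy hxy
      rcases Finset.mem_insert.1 hx with rfl | hx' <;> rcases Finset.mem_insert.1 hy with rfl | hy'
      · exact (hxy rfl).elim
      · exact fun h => hcon y hy' hb (hsymm _ _ h)
      · exact hcon x hx' hb
      · exact hF'.2 x hx' y hy' hxy⟩
    rw [Finset.card_insert_of_notMem hbF] at this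
    omega
  refine (Finset.card_le_card hcover).trans (Finset.card_biUnion_le_card_mul _ _ _ fun a ha => ?_)
  exact hC a (hF'.1 ha) _ (Finset.filter_subset _ _) fun b hb => (Finset.mem_filter.1 hb).2

/-- If `g` and `h` act with comparable distortion at `p` and send `p` to nearby points, then
`g⁻¹ * h` is bounded. -/
lemma abs_inv_mul_apply_le {g h : SL(2, ℝ)} {p α β κ D T : ℝ} (hT : 0 < T) (hα : 0 < α)
    (hg1 : α * T ≤ |realDenom g p|) (hg2 : |realDenom g p| ≤ β * T)
    (hh1 : α * T ≤ |realDenom h p|) (hh2 : |realDenom h p| ≤ β * T)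
    (hgc : |g 1 0| ≤ κ * T) (hhc : |h 1 0| ≤ κ * T)
    (hD : |realMoebius g p - realMoebius h p| ≤ D / T ^ 2) (i j : Fin 2) :
    |(g⁻¹ * h) i j| ≤
      (β / α + β * κ * D + β ^ 2 * D + 2 * (κ / α) + κ ^ 2 * D) * (1 + |p|) ^ 2 := by
  have hαT : 0 < α * T := by positivity
  have hu0 : realDenom g p ≠ 0 := abs_pos.1 (hαT.trans_le hg1)
  have hv0 : realDenom h p ≠ 0 := abs_pos.1 (hαT.trans_le hh1)
  have hy := realMoebius_mul_realDenom g hu0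
  have hz := realMoebius_mul_realDenom h hv0
  have hu : realDenom g p = g 1 0 * p + g 1 1 := rfl
  have hv : realDenom h p = h 1 0 * p + h 1 1 := rfl
  have hdg := sl2_det_eq g
  have hdh := sl2_det_eq h
  set u := realDenom g p
  set v := realDenom h p
  set y := realMoebius g p
  set z := realMoebius h p
  have hβ : 0 ≤ β := by
    have : 0 < β * T := hαT.trans_le (hg1.trans hg2)
    exact (pos_of_mul_pos_left this hT.le).le
  have hκ : 0 ≤ κ := by
    have : 0 ≤ κ * T := (abs_nonneg _).trans hgc
    exact nonneg_of_mul_nonneg_left this hT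
  have hD0 : 0 ≤ D := by
    have : 0 ≤ D / T ^ 2 := (abs_nonneg _).trans hD
    by_contra hcon
    push Not at hcon
    have := div_neg_of_neg_of_pos hcon (by positivity : 0 < T ^ 2)
    linarith
  set Δ := z - y with hΔ
  have hΔD : |Δ| ≤ D / T ^ 2 := by rw [hΔ, abs_sub_comm]; exact hD
  have hquot : ∀ {x w k : ℝ}, |x| ≤ k * T → α * T ≤ |w| → |x / w| ≤ k / α := by
    intro x w k hx hw
    rw [abs_div]
    calc |x| / |w| ≤ (k * T) / (α * T) :=
          div_le_div₀ ((abs_nonneg _).trans hx) hx hαT hw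
      _ = k / α := by field_simp
  have hprod : ∀ {x w k l : ℝ}, |x| ≤ k * T → |w| ≤ l * T → 0 ≤ k → |x * Δ * w| ≤ k * l * D := by
    intro x w k l hx hw hk
    rw [abs_mul, abs_mul]
    calc |x| * |Δ| * |w| ≤ (k * T) * (D / T ^ 2) * (l * T) := by gcongr
      _ = k * l * D := by field_simp
  have ha : g 0 0 = 1 / u + y * g 1 0 := by
    field_simp
    linear_combination hdg + g 0 0 * hu - g 1 0 * hy
  have ha' : h 0 0 = 1 / v + z * h 1 0 := by
    field_simp
    linear_combination hdh + h 0 0 * hv - h 1 0 * hz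
  have hb : g 0 1 = y * u - g 0 0 * p := by linear_combination -hy
  have hb' : h 0 1 = z * v - h 0 0 * p := by linear_combination -hz
  have hd : g 1 1 = u - g 1 0 * p := by linear_combination -hu
  have hd' : h 1 1 = v - h 1 0 * p := by linear_combination -hv
  set q00 := u / v + u * Δ * h 1 0 with hq00
  set q01 := u * Δ * v with hq01
  set q10 := h 1 0 / u - g 1 0 / v - g 1 0 * Δ * h 1 0 with hq10
  set q11 := v / u - g 1 0 * Δ * v with hq11
  set Q := β / α + β * κ * D + β ^ 2 * D + 2 * (κ / α) + κ ^ 2 * D with hQ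
  have e1 : 0 ≤ β / α := by positivity
  have e2 : 0 ≤ β * κ * D := by positivity
  have e3 : 0 ≤ β ^ 2 * D := by positivity
  have e4 : 0 ≤ κ / α := by positivity
  have e5 : 0 ≤ κ ^ 2 * D := by positivity
  have b00 : |q00| ≤ Q := by
    have := abs_add_le (u / v) (u * Δ * h 1 0)
    have h1 := hquot hg2 hh1
    have h2 := hprod hg2 hhc hβ
    linarith
  have b01 : |q01| ≤ Q := by
    have h2 := hprod hg2 hh2 hβ
    have : β * β * D = β ^ 2 * D := by ring
    linarith
  have b10 : |q10| ≤ Q := by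
    have := abs_sub (h 1 0 / u - g 1 0 / v) (g 1 0 * Δ * h 1 0)
    have := abs_sub (h 1 0 / u) (g 1 0 / v)
    have h1 := hquot hhc hg1
    have h3 := hquot hgc hh1
    have h2 := hprod hgc hhc hκ
    have : κ * κ * D = κ ^ 2 * D := by ring
    linarith
  have b11 : |q11| ≤ Q := by
    have := abs_sub (v / u) (g 1 0 * Δ * v)
    have h1 := hquot hh2 hg1
    have h2 := hprod hgc hh2 hκ
    have : κ * β * D = β * κ * D := by ring
    linarith
  have hQ0 : 0 ≤ Q := (abs_nonneg _).trans b00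
  have i00 : (g⁻¹ * h) 0 0 = q00 + p * q10 := by
    rw [sl2_mul_apply]
    simp only [Matrix.SpecialLinearGroup.coe_inv, Matrix.adjugate_fin_two,
      Matrix.of_apply, Matrix.cons_val_zero, Matrix.cons_val_one, Matrix.cons_val', Matrix.cons_val_fin_one]
    rw [hb, hd, ha, ha', hq00, hq10, hΔ]
    field_simp
    ring
  have i01 : (g⁻¹ * h) 0 1 = q01 + p * q11 - p * (q00 + p * q10) := by
    rw [sl2_mul_apply]
    simp only [Matrix.SpecialLinearGroup.coe_inv, Matrix.adjugate_fin_two,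
      Matrix.of_apply, Matrix.cons_val_zero, Matrix.cons_val_one, Matrix.cons_val', Matrix.cons_val_fin_one]
    rw [hb, hd, hb', hd', ha, ha', hq00, hq10, hq01, hq11, hΔ]
    field_simp
    ring
  have i10 : (g⁻¹ * h) 1 0 = q10 := by
    rw [sl2_mul_apply]
    simp only [Matrix.SpecialLinearGroup.coe_inv, Matrix.adjugate_fin_two,
      Matrix.of_apply, Matrix.cons_val_zero, Matrix.cons_val_one, Matrix.cons_val', Matrix.cons_val_fin_one]
    rw [ha, ha', hq10, hΔ]
    field_simp
    ring
  have i11 : (g⁻¹ * h) 1 1 = q11 - p * q10 := by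
    rw [sl2_mul_apply]
    simp only [Matrix.SpecialLinearGroup.coe_inv, Matrix.adjugate_fin_two,
      Matrix.of_apply, Matrix.cons_val_zero, Matrix.cons_val_one, Matrix.cons_val', Matrix.cons_val_fin_one]
    rw [hb', hd', ha, ha', hq10, hq11, hΔ]
    field_simp
    ring
  have hp := abs_nonneg p
  have m10 : |p * q10| ≤ |p| * Q := by rw [abs_mul]; gcongr
  have m11 : |p * q11| ≤ |p| * Q := by rw [abs_mul]; gcongr
  have hpQ : 0 ≤ |p| * Q := by positivity
  have hppQ : 0 ≤ |p| * (|p| * Q) := by positivity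
  have hexp : Q * (1 + |p|) ^ 2 = Q + 2 * (|p| * Q) + |p| * (|p| * Q) := by ring
  have m00 : |q00 + p * q10| ≤ Q + |p| * Q := (abs_add_le _ _).trans (add_le_add b00 m10)
  rw [hexp]
  fin_cases i <;> fin_cases j
  · change |(g⁻¹ * h) 0 0| ≤ _
    rw [i00]; linarith
  · change |(g⁻¹ * h) 0 1| ≤ _
    rw [i01]
    have h1 := abs_sub (q01 + p * q11) (p * (q00 + p * q10))
    have h2 := abs_add_le q01 (p * q11)
    have h3 : |p * (q00 + p * q10)| ≤ |p| * (Q + |p| * Q) := by rw [abs_mul]; gcongr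
    linarith
  · change |(g⁻¹ * h) 1 0| ≤ _
    rw [i10]; linarith
  · change |(g⁻¹ * h) 1 1| ≤ _
    rw [i11]
    have h1 := abs_sub q11 (p * q10)
    linarith

/-- Uniform estimates for the Möbius action, near an eigenvector `(p, 1)` of `A` with eigenvalue
`τ`, of an element of `SL(2, ℝ)` close to a large multiple of `A`. -/
lemma estimates_of_near {A : Fin 2 → Fin 2 → ℝ} {p τ : ℝ} (hτ : τ ≠ 0)
    (h1 : A 1 0 * p + A 1 1 = τ) (h0 : A 0 0 * p + A 0 1 = τ * p) :
    ∃ η > 0, ∃ ε > 0, ∀ (g : SL(2, ℝ)) (T : ℝ), 0 < T → 3 ≤ T * |τ| →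
      (∀ i j, |g i j - T * A i j| ≤ ε * T) →
      |g 1 0| ≤ (|A 1 0| + 1) * T ∧ ∀ x, |x - p| ≤ η →
        |τ| / 2 * T ≤ |realDenom g x| ∧ |realDenom g x| ≤ 2 * |τ| * T ∧
        |realMoebius g x - p| ≤ η ∧
        |realMoebius g x - realMoebius g p| ≤ 4 * η / τ ^ 2 / T ^ 2 := by
  have hτ0 : 0 < |τ| := abs_pos.2 hτ
  have hA := abs_nonneg (A 1 0)
  have hp := abs_nonneg p
  set η := |τ| / (4 * (|A 1 0| + 1)) with hη
  have hη0 : 0 < η := by positivity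
  have hAη : |A 1 0| * η ≤ |τ| / 4 := by
    rw [hη, mul_div_assoc', div_le_div_iff₀ (by positivity) (by norm_num)]
    nlinarith
  set ε := min 1 (min (|τ| / (4 * (|p| + η + 1))) (η * |τ| / (4 * (|p| + 1) ^ 2))) with hε
  have hε0 : 0 < ε := by positivity
  have hε1 : ε ≤ 1 := min_le_left _ _
  have hε2 : ε * (|p| + η + 1) ≤ |τ| / 4 := by
    have : ε ≤ |τ| / (4 * (|p| + η + 1)) := (min_le_right _ _).trans (min_le_left _ _)
    rw [le_div_iff₀ (by positivity)] at this
    linarith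
  have hε3 : ε * (|p| + 1) ^ 2 ≤ η * |τ| / 4 := by
    have : ε ≤ η * |τ| / (4 * (|p| + 1) ^ 2) := (min_le_right _ _).trans (min_le_right _ _)
    rw [le_div_iff₀ (by positivity)] at this
    linarith
  refine ⟨η, hη0, ε, hε0, fun g T hT hTτ hg => ?_⟩
  have hden : ∀ x, |x - p| ≤ η → |realDenom g x - T * τ| ≤ |τ| / 2 * T := by
    intro x hx
    have e : realDenom g x - T * τ =
        T * (A 1 0 * (x - p)) + ((g 1 0 - T * A 1 0) * x + (g 1 1 - T * A 1 1)) := by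
      rw [realDenom, ← h1]; ring
    have hx' : |x| ≤ |p| + η := by
      have := abs_sub_abs_le_abs_sub x p
      linarith
    rw [e]
    calc _ ≤ |T * (A 1 0 * (x - p))| + (|(g 1 0 - T * A 1 0) * x| + |g 1 1 - T * A 1 1|) :=
          (abs_add_le _ _).trans (by gcongr; exact abs_add_le _ _)
      _ ≤ T * (|A 1 0| * η) + (ε * T * (|p| + η) + ε * T) := by
          rw [abs_mul, abs_mul, abs_mul, abs_of_pos hT]
          gcongr
          · exact hg 1 0
          · exact hg 1 1
      _ = T * (|A 1 0| * η) + T * (ε * (|p| + η + 1)) := by ring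
      _ ≤ T * (|τ| / 4) + T * (|τ| / 4) := by gcongr
      _ = |τ| / 2 * T := by ring
  have hlow : ∀ x, |x - p| ≤ η → |τ| / 2 * T ≤ |realDenom g x| := by
    intro x hx
    have h2 := abs_sub_abs_le_abs_sub (T * τ) (realDenom g x)
    rw [abs_sub_comm, abs_mul, abs_of_pos hT] at h2
    linarith [hden x hx]
  have hpp : |p - p| ≤ η := by simpa using hη0.le
  have hcontr : ∀ x, |x - p| ≤ η →
      |realMoebius g x - realMoebius g p| ≤ 4 * η / τ ^ 2 / T ^ 2 := by
    intro x hx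
    have hx0 : 0 < |realDenom g x| := (by positivity : 0 < |τ| / 2 * T).trans_le (hlow x hx)
    have hp0 : 0 < |realDenom g p| := (by positivity : 0 < |τ| / 2 * T).trans_le (hlow p hpp)
    rw [realMoebius_sub g (abs_pos.1 hx0) (abs_pos.1 hp0), abs_div, abs_mul]
    calc _ ≤ η / ((|τ| / 2 * T) * (|τ| / 2 * T)) := by
          gcongr
          · exact hlow x hx
          · exact hlow p hpp
      _ = 4 * η / |τ| ^ 2 / T ^ 2 := by field_simp; norm_num
      _ = _ := by rw [sq_abs]
  refine ⟨?_, fun x hx => ⟨hlow x hx, ?_, ?_, hcontr x hx⟩⟩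
  · have h2 := abs_sub_abs_le_abs_sub (g 1 0) (T * A 1 0)
    rw [abs_mul, abs_of_pos hT] at h2
    nlinarith [hg 1 0]
  · have h2 := abs_sub_abs_le_abs_sub (realDenom g x) (T * τ)
    rw [abs_mul, abs_of_pos hT] at h2
    nlinarith [hden x hx]
  · have hp0 : 0 < |realDenom g p| := (by positivity : 0 < |τ| / 2 * T).trans_le (hlow p hpp)
    have hp0' := abs_pos.1 hp0
    have e : realMoebius g p - p = ((g 0 0 - T * A 0 0) * p + (g 0 1 - T * A 0 1) -
        p * ((g 1 0 - T * A 1 0) * p + (g 1 1 - T * A 1 1))) / realDenom g p := by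
      rw [eq_div_iff hp0', sub_mul, realMoebius_mul_realDenom g hp0', realDenom]
      linear_combination T * h0 - T * p * h1
    have hb : ∀ i, |(g i 0 - T * A i 0) * p + (g i 1 - T * A i 1)| ≤ ε * T * (|p| + 1) := by
      intro i
      calc _ ≤ |(g i 0 - T * A i 0) * p| + |g i 1 - T * A i 1| := abs_add_le _ _
        _ ≤ ε * T * |p| + ε * T := by
          rw [abs_mul]; gcongr
          · exact hg i 0
          · exact hg i 1
        _ = _ := by ring
    have h3 : |realMoebius g p - p| ≤ η / 2 := by
      rw [e, abs_div, div_le_iff₀ hp0]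
      calc _ ≤ ε * T * (|p| + 1) + |p| * (ε * T * (|p| + 1)) := by
            refine (abs_sub _ _).trans ?_
            rw [abs_mul]; gcongr
            · exact hb 0
            · exact hb 1
        _ = T * (ε * (|p| + 1) ^ 2) := by ring
        _ ≤ T * (η * |τ| / 4) := by gcongr
        _ = η / 2 * (|τ| / 2 * T) := by ring
        _ ≤ _ := by gcongr; exact hlow p hpp
    have h4 : 4 * η / τ ^ 2 / T ^ 2 ≤ η / 2 := by
      rw [← sq_abs τ, div_div, div_le_div_iff₀ (by positivity) (by norm_num)]
      have : 9 ≤ |τ| ^ 2 * T ^ 2 := by nlinarith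
      nlinarith
    have h5 := abs_add_le (realMoebius g x - realMoebius g p) (realMoebius g p - p)
    rw [sub_add_sub_cancel] at h5
    linarith [hcontr x hx]

/-- If, at arbitrarily large scales `T`, a discrete group has much more than `T ^ (2 * t)` elements
close to `T • A`, where `A` has an eigenvector `(p, 1)` with nonzero eigenvalue, then the uniform
conical limit set has dimension at least `t`. -/
lemma le_dimH_of_many_near {Γ : Subgroup SL(2, ℝ)}
    (hfin : ∀ R : ℝ, {g : SL(2, ℝ) | g ∈ Γ ∧ ∀ i j, |g i j| ≤ R}.Finite)
    {A : Fin 2 → Fin 2 → ℝ} {p τ : ℝ} (hτ : τ ≠ 0)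
    (h1 : A 1 0 * p + A 1 1 = τ) (h0 : A 0 0 * p + A 0 1 = τ * p) {t : NNReal} (ht : 0 < t)
    (hcount : ∀ ε > 0, ∀ M : ℝ, ∃ T : ℝ, M ≤ T ∧ ∃ F : Finset SL(2, ℝ), (∀ g ∈ F, g ∈ Γ) ∧
      M * (T ^ 2) ^ (t : ℝ) ≤ F.card ∧ ∀ g ∈ F, ∀ i j, |g i j - T * A i j| ≤ ε * T) :
    (t : ENNReal) ≤ dimH {x : ℝ | IsUniformConicalLimitPoint Γ (projPt x)} := by
  obtain ⟨η, hη, ε, hε, hest⟩ := estimates_of_near hτ h1 h0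
  have hτ0 : 0 < |τ| := abs_pos.2 hτ
  set D := 8 * η / τ ^ 2 + 1 with hD
  set α := |τ| / 2 with hα
  set β := 2 * |τ| with hβ
  set κ := |A 1 0| + 1
  set R := (β / α + β * κ * D + β ^ 2 * D + 2 * (κ / α) + κ ^ 2 * D) * (1 + |p|) ^ 2
  set C := (hfin R).toFinset.card with hC
  obtain ⟨T, hT, F, hFΓ, hFcard, hF⟩ :=
    hcount ε hε (max 1 (max (3 / |τ|) (C * (β ^ 2) ^ (t : ℝ))))
  have hT1 : 1 ≤ T := (le_max_left _ _).trans hT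
  have hT0 : 0 < T := by linarith
  have hTτ : 3 ≤ T * |τ| := by
    rw [← div_le_iff₀ hτ0]
    exact (le_max_left _ _).trans ((le_max_right _ _).trans hT)
  have hCcard : C * (β ^ 2 * T ^ 2) ^ (t : ℝ) ≤ F.card := by
    rw [Real.mul_rpow (by positivity) (by positivity), ← mul_assoc]
    refine le_trans ?_ hFcard
    gcongr
    exact (le_max_right _ _).trans (le_max_right _ _)
  have hest' := fun g hg => hest g T hT0 hTτ (hF g hg)
  have hpp : |p - p| ≤ η := by simpa using hη.le
  obtain ⟨F', hF'F, hsep, hcard⟩ := exists_independent_subset F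
    (fun g h => |realMoebius g p - realMoebius h p| ≤ D / T ^ 2) (C := C)
    (fun g => by
      simp only [sub_self, abs_zero]
      positivity)
    (fun g h => by rw [abs_sub_comm]; exact id)
    (fun g hg G hG hr => by
      refine Finset.card_le_card_of_injOn (fun h => g⁻¹ * h) (fun h hh => ?_)
        (fun _ _ _ _ => mul_left_cancel)
      obtain ⟨c1, e1⟩ := hest' g hg
      obtain ⟨c2, e2⟩ := hest' h (hG hh)
      obtain ⟨a1, b1, -⟩ := e1 p hpp
      obtain ⟨a2, b2, -⟩ := e2 p hpp
      rw [Finset.mem_coe, Set.Finite.mem_toFinset]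
      exact ⟨Γ.mul_mem (Γ.inv_mem (hFΓ g hg)) (hFΓ h (hG hh)), fun i j =>
        abs_inv_mul_apply_le hT0 (by positivity) a1 b1 a2 b2 c1 c2 (hr h hh) i j⟩)
  have hCpos : 0 < C := by
    rw [hC, Finset.card_pos]
    by_contra hcon
    rw [Finset.not_nonempty_iff_eq_empty] at hcon
    have hF0 : 0 < F.card := by
      have : 0 < max 1 (max (3 / |τ|) (C * (β ^ 2) ^ (t : ℝ))) * (T ^ 2) ^ (t : ℝ) := by positivity
      exact_mod_cast this.trans_le hFcard
    rw [hC, hcon] at hcard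
    simp only [Finset.card_empty, mul_zero] at hcard
    omega
  have hN : (β ^ 2 * T ^ 2) ^ (t : ℝ) ≤ F'.card := by
    have h2 : (F.card : ℝ) ≤ F'.card * C := by exact_mod_cast hcard
    have h3 : (0 : ℝ) < C := by exact_mod_cast hCpos
    refine le_of_mul_le_mul_left (a := (C : ℝ)) ?_ h3
    linarith
  set e := F'.equivFin.symm
  have heF : ∀ i, (e i : SL(2, ℝ)) ∈ F := fun i => hF'F (e i).2
  have hmem : ∀ {x}, x ∈ Set.Icc (p - η) (p + η) ↔ |x - p| ≤ η := by
    intro x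
    rw [abs_le, Set.mem_Icc]
    constructor <;> rintro ⟨h2, h3⟩ <;> constructor <;> linarith
  have hsys : IsCantorSystem (Set.Icc (p - η) (p + η)) (β ^ 2 * T ^ 2) (1 / T ^ 2)
      (fun i => (e i : SL(2, ℝ))) := by
    refine ⟨fun i x hx => ?_, fun i x hx => ?_, fun i x hx => ?_, fun i k hik x hx y hy => ?_⟩
    · exact hmem.2 ((hest' _ (heF i)).2 x (hmem.1 hx)).2.2.1
    · have := ((hest' _ (heF i)).2 x (hmem.1 hx)).1
      have : 3 / 2 ≤ |realDenom (e i : SL(2, ℝ)) x| := by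
        have : α * T = T * |τ| / 2 := by rw [hα]; ring
        linarith
      rw [← sq_abs]
      nlinarith
    · have := ((hest' _ (heF i)).2 x (hmem.1 hx)).2.1
      rw [← sq_abs, ← mul_pow]
      exact pow_le_pow_left₀ (abs_nonneg _) this 2
    · have a1 := ((hest' _ (heF i)).2 x (hmem.1 hx)).2.2.2
      have a2 := ((hest' _ (heF k)).2 y (hmem.1 hy)).2.2.2
      have a3 := hsep _ (e i).2 _ (e k).2 fun h => hik (e.injective (Subtype.ext h))
      push Not at a3
      have a4 : D / T ^ 2 = 2 * (4 * η / τ ^ 2 / T ^ 2) + 1 / T ^ 2 := by rw [hD]; ring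
      have a5 : |realMoebius (e i) p - realMoebius (e k) p| ≤
          |realMoebius (e i) x - realMoebius (e i) p| +
          (|realMoebius (e i) x - realMoebius (e k) y| +
            |realMoebius (e k) y - realMoebius (e k) p|) := by
        have b1 := abs_sub_le (realMoebius (e i : SL(2, ℝ)) p) (realMoebius (e i : SL(2, ℝ)) x)
          (realMoebius (e k : SL(2, ℝ)) p)
        have b2 := abs_sub_le (realMoebius (e i : SL(2, ℝ)) x) (realMoebius (e k : SL(2, ℝ)) y)
          (realMoebius (e k : SL(2, ℝ)) p)
        rw [abs_sub_comm (realMoebius (e i : SL(2, ℝ)) p) (realMoebius (e i : SL(2, ℝ)) x)] at b1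
        linarith
      linarith
  refine hsys.le_dimH (by positivity) isCompact_Icc (Set.nonempty_Icc.2 (by linarith))
    (fun i => hFΓ _ (heF i)) ht ?_ hN
  have : β ^ 2 * T ^ 2 = 4 * (T * |τ|) ^ 2 := by rw [hβ]; ring
  rw [this]
  nlinarith

/-- A discrete subgroup has finitely many elements with bounded entries. -/
lemma finite_setOf_entries_le {Γ : Subgroup SL(2, ℝ)} (hdisc : DiscreteTopology Γ) (R : ℝ) :
    {g : SL(2, ℝ) | g ∈ Γ ∧ ∀ i j, |g i j| ≤ R}.Finite := by
  have hbox : IsCompact {A : Matrix (Fin 2) (Fin 2) ℝ | ∀ i j, |A i j| ≤ R} := by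
    have h1 : {A : Matrix (Fin 2) (Fin 2) ℝ | ∀ i j, |A i j| ≤ R} =
        Set.univ.pi fun _ : Fin 2 => Set.univ.pi fun _ : Fin 2 => Set.Icc (-R) R := by
      ext A
      constructor
      · exact fun h i _ j _ => abs_le.1 (h i j)
      · exact fun h i j => abs_le.2 (h i trivial j trivial)
    rw [h1]
    exact isCompact_univ_pi fun _ => isCompact_univ_pi fun _ => isCompact_Icc
  have hgrp : IsTopologicalGroup SL(2, ℝ) := Matrix.SpecialLinearGroup.topologicalGroup
  have hT1 : T1Space SL(2, ℝ) := Matrix.SpecialLinearGroup.instT1Space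
  have h2 : IsCompact {g : SL(2, ℝ) | ∀ i j, |g i j| ≤ R} :=
    (Matrix.SpecialLinearGroup.isClosedEmbedding_val (n := Fin 2) (R := ℝ)).isCompact_preimage hbox
  have h3 : IsClosed (Γ : Set SL(2, ℝ)) := Subgroup.isClosed_of_discrete
  have h4 : IsDiscrete (Γ : Set SL(2, ℝ)) := isDiscrete_iff_discreteTopology.2 hdisc
  refine ((h2.inter_left h3).finite (h4.mono Set.inter_subset_left)).subset ?_
  exact fun g hg => ⟨hg.1, hg.2⟩

/-- The array of entries of an element of `SL(2, ℝ)`, in a space with the supremum norm. -/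
def entries (g : SL(2, ℝ)) : Fin 2 → Fin 2 → ℝ := fun i j => g i j

lemma abs_apply_le_norm (A : Fin 2 → Fin 2 → ℝ) (i j : Fin 2) : |A i j| ≤ ‖A‖ :=
  (norm_le_pi_norm (A i) j).trans (norm_le_pi_norm A i)

lemma norm_le_of_abs_apply_le {A : Fin 2 → Fin 2 → ℝ} {r : ℝ} (hr : 0 ≤ r)
    (h : ∀ i j, |A i j| ≤ r) : ‖A‖ ≤ r :=
  (pi_norm_le_iff_of_nonneg hr).2 fun i => (pi_norm_le_iff_of_nonneg hr).2 (h i)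

/-- The elements of `Γ` whose norm lies in `[2 ^ n, 2 ^ (n + 1))`. -/
def shell (Γ : Subgroup SL(2, ℝ)) (n : ℕ) : Set SL(2, ℝ) :=
  {g | g ∈ Γ ∧ 2 ^ n ≤ ‖entries g‖ ∧ ‖entries g‖ < 2 ^ (n + 1)}

/-- If the shells of `Γ` have more than `q ^ n` elements up to any constant, then so do their
intersections with small conical neighbourhoods of a suitable direction. -/
lemma exists_direction {Γ : Subgroup SL(2, ℝ)} {q : ℝ}
    (h : ¬ ∃ M : ℕ, ∀ n ≥ M, ∀ F : Finset SL(2, ℝ), (F : Set SL(2, ℝ)) ⊆ shell Γ n →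
      (F.card : ℝ) ≤ M * q ^ n) :
    ∃ A : Fin 2 → Fin 2 → ℝ, A ≠ 0 ∧ ∀ ε > 0, ∀ M : ℕ, ∃ n ≥ M, ∃ F : Finset SL(2, ℝ),
      (F : Set SL(2, ℝ)) ⊆ shell Γ n ∧ (M : ℝ) * q ^ n < F.card ∧
      ∀ g ∈ F, ∀ i j, |g i j - 2 ^ n * A i j| ≤ ε * 2 ^ n := by
  classical
  by_contra! hcon
  have hK : IsCompact (Metric.closedBall (0 : Fin 2 → Fin 2 → ℝ) 2 ∩ {A | 1 ≤ ‖A‖}) :=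
    (isCompact_closedBall _ _).inter_right (isClosed_le continuous_const continuous_norm)
  have key := hK.induction_on (p := fun s => ∃ M : ℕ, ∀ n ≥ M, ∀ F : Finset SL(2, ℝ),
    (F : Set SL(2, ℝ)) ⊆ shell Γ n → (∀ g ∈ F, ((2 : ℝ) ^ n)⁻¹ • entries g ∈ s) →
      (F.card : ℝ) ≤ M * q ^ n) ?_ ?_ ?_ ?_
  · obtain ⟨M, hM⟩ := key
    refine h ⟨M, fun n hn F hF => hM n hn F hF fun g hg => ?_⟩
    obtain ⟨-, h1, h2⟩ := hF hg
    have h3 : ‖((2 : ℝ) ^ n)⁻¹ • entries g‖ = ‖entries g‖ / 2 ^ n := by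
      rw [norm_smul, norm_inv, norm_pow, Real.norm_ofNat, inv_mul_eq_div]
    refine ⟨?_, ?_⟩
    · rw [mem_closedBall_zero_iff, h3, div_le_iff₀ (by positivity)]
      rw [pow_succ] at h2
      linarith
    · rw [Set.mem_ofPred_eq]
      rw [h3, le_div_iff₀ (by positivity), one_mul]
      exact h1
  · refine ⟨0, fun n _ F _ hF => ?_⟩
    have : F = ∅ := Finset.eq_empty_of_forall_notMem fun g hg => hF g hg
    simp [this]
  · rintro s s' hs ⟨M, hM⟩
    exact ⟨M, fun n hn F hF hF' => hM n hn F hF fun g hg => hs (hF' g hg)⟩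
  · rintro s s' ⟨M, hM⟩ ⟨M', hM'⟩
    refine ⟨M + M', fun n hn F hF hF' => ?_⟩
    have h1 := hM n (by omega) (F.filter fun g => ((2 : ℝ) ^ n)⁻¹ • entries g ∈ s)
      (fun g hg => hF (Finset.mem_filter.1 hg).1) fun g hg => (Finset.mem_filter.1 hg).2
    have h2 := hM' n (by omega) (F.filter fun g => ((2 : ℝ) ^ n)⁻¹ • entries g ∉ s)
      (fun g hg => hF (Finset.mem_filter.1 hg).1)
      fun g hg => (hF' g (Finset.mem_filter.1 hg).1).resolve_left (Finset.mem_filter.1 hg).2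
    have h3 := Finset.card_filter_add_card_filter_not (s := F)
      fun g => ((2 : ℝ) ^ n)⁻¹ • entries g ∈ s
    have h4 : (F.card : ℝ) = (F.filter fun g => ((2 : ℝ) ^ n)⁻¹ • entries g ∈ s).card +
        (F.filter fun g => ((2 : ℝ) ^ n)⁻¹ • entries g ∉ s).card := by exact_mod_cast h3.symm
    push_cast
    linarith
  · rintro A ⟨-, hA⟩
    have hA0 : A ≠ 0 := by
      rintro rfl
      change (1 : ℝ) ≤ ‖(0 : Fin 2 → Fin 2 → ℝ)‖ at hA
      norm_num at hA
    obtain ⟨ε, hε, M, hM⟩ := hcon A hA0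
    refine ⟨Metric.ball A ε, mem_nhdsWithin_of_mem_nhds (Metric.ball_mem_nhds A hε), M,
      fun n hn F hF hF' => ?_⟩
    by_contra! hlt
    obtain ⟨g, hg, i, j, hij⟩ := hM n hn F hF hlt
    have h1 := mem_ball_iff_norm.1 (hF' g hg)
    have h2 := abs_apply_le_norm (((2 : ℝ) ^ n)⁻¹ • entries g - A) i j
    have h3 : g i j - 2 ^ n * A i j = 2 ^ n * (((2 : ℝ) ^ n)⁻¹ • entries g - A) i j := by
      simp only [Pi.sub_apply, Pi.smul_apply, smul_eq_mul, entries]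
      field_simp
    rw [h3, abs_mul, abs_of_pos (by positivity : (0 : ℝ) < 2 ^ n), mul_comm] at hij
    have h4 := lt_of_mul_lt_mul_left hij (by positivity)
    linarith

/-- A direction approximated by arbitrarily large elements of `SL(2, ℝ)` is singular. -/
lemma direction_det_eq_zero {A : Fin 2 → Fin 2 → ℝ}
    (h : ∀ ε > 0, ∀ M : ℕ, ∃ n ≥ M, ∃ g : SL(2, ℝ), ∀ i j, |g i j - 2 ^ n * A i j| ≤ ε * 2 ^ n) :
    A 0 0 * A 1 1 - A 0 1 * A 1 0 = 0 := by
  by_contra hne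
  have hcont : Continuous fun X : Fin 2 → Fin 2 → ℝ => |X 0 0 * X 1 1 - X 0 1 * X 1 0| := by
    fun_prop
  have hpos : 0 < |A 0 0 * A 1 1 - A 0 1 * A 1 0| := abs_pos.2 hne
  obtain ⟨ε, hε, hball⟩ := Metric.isOpen_iff.1
    (isOpen_lt (continuous_const (y := |A 0 0 * A 1 1 - A 0 1 * A 1 0| / 2)) hcont) A
    (half_lt_self hpos)
  obtain ⟨M, hM⟩ := exists_pow_lt_of_lt_one (half_pos hpos) (by norm_num : (4 : ℝ)⁻¹ < 1)
  obtain ⟨n, hn, g, hg⟩ := h (ε / 2) (half_pos hε) M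
  have h1 : ((2 : ℝ) ^ n)⁻¹ • entries g ∈ Metric.ball A ε := by
    rw [mem_ball_iff_norm]
    refine (norm_le_of_abs_apply_le (half_pos hε).le fun i j => ?_).trans_lt (half_lt_self hε)
    have h3 : g i j - 2 ^ n * A i j = 2 ^ n * (((2 : ℝ) ^ n)⁻¹ • entries g - A) i j := by
      simp only [Pi.sub_apply, Pi.smul_apply, smul_eq_mul, entries]
      field_simp
    have h4 := hg i j
    rw [h3, abs_mul, abs_of_pos (by positivity : (0 : ℝ) < 2 ^ n), mul_comm] at h4
    exact le_of_mul_le_mul_right h4 (by positivity)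
  have h2 := hball h1
  simp only [Set.mem_ofPred_eq, Pi.smul_apply, smul_eq_mul, entries] at h2
  have h5 : ((2 : ℝ) ^ n)⁻¹ * g 0 0 * (((2 : ℝ) ^ n)⁻¹ * g 1 1) -
      ((2 : ℝ) ^ n)⁻¹ * g 0 1 * (((2 : ℝ) ^ n)⁻¹ * g 1 0) = (4 : ℝ)⁻¹ ^ n := by
    have h6 : (4 : ℝ)⁻¹ ^ n = ((2 : ℝ) ^ n)⁻¹ * ((2 : ℝ) ^ n)⁻¹ := by
      rw [← inv_pow, ← mul_pow]; norm_num
    rw [h6]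
    linear_combination ((2 : ℝ) ^ n)⁻¹ * ((2 : ℝ) ^ n)⁻¹ * sl2_det_eq g
  rw [h5, abs_of_pos (by positivity : (0 : ℝ) < 4⁻¹ ^ n)] at h2
  have := pow_le_pow_of_le_one (by norm_num : (0 : ℝ) ≤ 4⁻¹) (by norm_num) hn
  linarith

/-- A nonzero singular `2 × 2` matrix has rank one. -/
lemma exists_rank_one {A : Fin 2 → Fin 2 → ℝ} (hA : A ≠ 0)
    (hdet : A 0 0 * A 1 1 - A 0 1 * A 1 0 = 0) :
    ∃ v w : Fin 2 → ℝ, v ≠ 0 ∧ w ≠ 0 ∧ ∀ i j, A i j = v i * w j := by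
  obtain ⟨i, hi⟩ := Function.ne_iff.1 hA
  obtain ⟨j, hij⟩ := Function.ne_iff.1 hi
  change A i j ≠ 0 at hij
  refine ⟨fun k => A k j / A i j, A i, fun h => ?_, hi, fun k l => ?_⟩
  · have := congrFun h i
    simp [hij] at this
  · rw [div_mul_eq_mul_div, eq_div_iff hij]
    fin_cases i <;> fin_cases j <;> fin_cases k <;> fin_cases l <;> simp <;>
      first | ring1 | linear_combination hdet | linear_combination -hdet

/-- A non-elementary purely hyperbolic group has no invariant line. -/
lemma exists_pairing_ne_zero {Γ : Subgroup SL(2, ℝ)} (hPH : PurelyHyperbolic Γ)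
    (hNE : IsNonElementary Γ) {v w : Fin 2 → ℝ} (hv : v ≠ 0) (hw : w ≠ 0) :
    ∃ k ∈ Γ, w ⬝ᵥ ((k : Matrix (Fin 2) (Fin 2) ℝ) *ᵥ v) ≠ 0 := by
  by_contra! hcon
  have heig : ∀ k ∈ Γ, ∃ c : ℝ, (k : Matrix (Fin 2) (Fin 2) ℝ) *ᵥ v = c • v := by
    intro k hk
    have h1 := hcon 1 Γ.one_mem
    have h2 := hcon k hk
    rw [Matrix.SpecialLinearGroup.coe_one, Matrix.one_mulVec] at h1
    generalize (k : Matrix (Fin 2) (Fin 2) ℝ) *ᵥ v = u at h2 ⊢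
    simp only [dotProduct, Fin.sum_univ_two] at h1 h2
    have h3 : u 0 * v 1 = u 1 * v 0 := by
      by_cases hw0 : w 0 = 0
      · have hw1 : w 1 ≠ 0 := fun h => hw (by ext i; fin_cases i <;> simp [hw0, h])
        have e1 : v 1 = 0 := by simpa [hw0, hw1] using h1
        have e2 : u 1 = 0 := by simpa [hw0, hw1] using h2
        rw [e1, e2]; ring
      · refine mul_left_cancel₀ hw0 ?_
        linear_combination v 1 * h2 - u 1 * h1
    by_cases hv0 : v 0 = 0
    · have hv1 : v 1 ≠ 0 := fun h => hv (by ext i; fin_cases i <;> simp [hv0, h])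
      refine ⟨u 1 / v 1, ?_⟩
      have e2 : u 0 = 0 := by simpa [hv0, hv1] using h3
      ext i
      fin_cases i
      · simp [hv0, e2]
      · simp [hv1]
    · refine ⟨u 0 / v 0, ?_⟩
      ext i
      fin_cases i
      · simp [hv0]
      · simp
        field_simp
        linarith
  refine hNE ⟨⊤, inferInstance, fun a _ b _ => ?_⟩
  obtain ⟨a, ha⟩ := a
  obtain ⟨b, hb⟩ := b
  refine Subtype.ext ?_
  change a * b = b * a
  obtain ⟨ca, hca⟩ := heig a ha
  obtain ⟨cb, hcb⟩ := heig b hb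
  by_contra hab
  set c := (b * a)⁻¹ * (a * b) with hc
  have hc1 : c ≠ 1 := fun h => hab (inv_mul_eq_one.1 h).symm
  have hcΓ : c ∈ Γ := Γ.mul_mem (Γ.inv_mem (Γ.mul_mem hb ha)) (Γ.mul_mem ha hb)
  have h1 : ((a * b : SL(2, ℝ)) : Matrix (Fin 2) (Fin 2) ℝ) *ᵥ v =
      ((b * a : SL(2, ℝ)) : Matrix (Fin 2) (Fin 2) ℝ) *ᵥ v := by
    rw [Matrix.SpecialLinearGroup.coe_mul, Matrix.SpecialLinearGroup.coe_mul,
      ← Matrix.mulVec_mulVec, ← Matrix.mulVec_mulVec, hca, hcb, Matrix.mulVec_smul,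
      Matrix.mulVec_smul, hca, hcb, smul_comm]
  have h2 : (c : Matrix (Fin 2) (Fin 2) ℝ) *ᵥ v = v := by
    rw [hc, Matrix.SpecialLinearGroup.coe_mul, ← Matrix.mulVec_mulVec, h1, Matrix.mulVec_mulVec,
      ← Matrix.SpecialLinearGroup.coe_mul, inv_mul_cancel, Matrix.SpecialLinearGroup.coe_one,
      Matrix.one_mulVec]
  have h3 : ((c : Matrix (Fin 2) (Fin 2) ℝ) - 1).det = 0 :=
    Matrix.exists_mulVec_eq_zero_iff.1 ⟨v, hv, by rw [Matrix.sub_mulVec, h2, Matrix.one_mulVec,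
      sub_self]⟩
  have h4 := sl2_det_eq c
  have h5 := hPH c hcΓ hc1
  change 2 < |Matrix.trace _| at h5
  rw [Matrix.trace_fin_two] at h5
  rw [Matrix.det_fin_two] at h3
  simp at h3
  have h6 : c 0 0 + c 1 1 = 2 := by linarith
  rw [h6] at h5
  norm_num at h5

lemma abs_sum_mul_mul_le {a b : Fin 2 → ℝ} {e : Fin 2 → Fin 2 → ℝ} {C ε : ℝ} (hC : 0 ≤ C)
    (ha : ∀ i, |a i| ≤ C) (hb : ∀ i, |b i| ≤ C) (he : ∀ i j, |e i j| ≤ ε) :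
    |∑ i, ∑ j, a i * e i j * b j| ≤ 4 * (C * ε * C) := by
  have h0 : 0 ≤ ε := (abs_nonneg _).trans (he 0 0)
  have h : ∀ i j, |a i * e i j * b j| ≤ C * ε * C := by
    intro i j
    rw [abs_mul, abs_mul]
    have := ha i
    have := hb j
    have := he i j
    gcongr
  calc _ ≤ ∑ i, ∑ j, |a i * e i j * b j| :=
        (Finset.abs_sum_le_sum_abs _ _).trans
          (Finset.sum_le_sum fun i _ => Finset.abs_sum_le_sum_abs _ _)
    _ ≤ ∑ _i : Fin 2, ∑ _j : Fin 2, C * ε * C :=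
        Finset.sum_le_sum fun i _ => Finset.sum_le_sum fun j _ => h i j
    _ = _ := by simp; ring

/-- If the shells of `Γ` grow faster than `4 ^ (t * n)`, then the uniform conical limit set has
dimension at least `t`. -/
lemma le_dimH_of_large_shells {Γ : Subgroup SL(2, ℝ)} (hdisc : DiscreteTopology Γ)
    (hPH : PurelyHyperbolic Γ) (hNE : IsNonElementary Γ) {t : NNReal} (ht : 0 < t)
    (h : ¬ ∃ M : ℕ, ∀ n ≥ M, ∀ F : Finset SL(2, ℝ), (F : Set SL(2, ℝ)) ⊆ shell Γ n →
      (F.card : ℝ) ≤ M * ((4 : ℝ) ^ (t : ℝ)) ^ n) :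
    (t : ENNReal) ≤ dimH {x : ℝ | IsUniformConicalLimitPoint Γ (projPt x)} := by
  classical
  obtain ⟨A, hA, hdir⟩ := exists_direction h
  have hdet : A 0 0 * A 1 1 - A 0 1 * A 1 0 = 0 := by
    refine direction_det_eq_zero fun ε hε M => ?_
    obtain ⟨n, hn, F, -, hcard, hF⟩ := hdir ε hε M
    have h1 : (0 : ℝ) < F.card := lt_of_le_of_lt (by positivity) hcard
    obtain ⟨g, hg⟩ := Finset.card_pos.1 (by exact_mod_cast h1 : 0 < F.card)
    exact ⟨n, hn, g, hF g hg⟩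
  obtain ⟨v, w, hv, hw, hvw⟩ := exists_rank_one hA hdet
  obtain ⟨a, haΓ, ha⟩ := exists_pairing_ne_zero hPH hNE hv
    (w := ![0, 1]) (fun h => by simpa using congrFun h 1)
  set u := (a : Matrix (Fin 2) (Fin 2) ℝ) *ᵥ v with hu
  have hu1 : u 1 ≠ 0 := by simpa [dotProduct, Fin.sum_univ_two] using ha
  obtain ⟨b, hbΓ, hb⟩ := exists_pairing_ne_zero hPH hNE
    (v := u) (fun h => hu1 (congrFun h 1)) hw
  set τ := w ⬝ᵥ ((b : Matrix (Fin 2) (Fin 2) ℝ) *ᵥ u) with hτ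
  have hτ' : τ = w 0 * (b 0 0 * u 0 + b 0 1 * u 1) + w 1 * (b 1 0 * u 0 + b 1 1 * u 1) := by
    rw [hτ]
    simp [dotProduct, Matrix.mulVec, Fin.sum_univ_two]
  have hui : ∀ i, u i = a i 0 * v 0 + a i 1 * v 1 := by
    intro i
    rw [hu]
    simp only [dotProduct, Matrix.mulVec, Fin.sum_univ_two]
  clear_value u τ
  set A' : Fin 2 → Fin 2 → ℝ := fun i j => ∑ k, ∑ l, a i k * A k l * b l j with hA'
  have hA'ij : ∀ i j, A' i j = u i * (w 0 * b 0 j + w 1 * b 1 j) := by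
    intro i j
    simp only [hA', Fin.sum_univ_two, hvw, hui]
    ring
  set C := max ‖entries a‖ ‖entries b‖ with hC
  have hC0 : 0 ≤ C := (norm_nonneg _).trans (le_max_left _ _)
  have haC : ∀ i j, |a i j| ≤ C := fun i j =>
    (abs_apply_le_norm (entries a) i j).trans (le_max_left _ _)
  have hbC : ∀ i j, |b i j| ≤ C := fun i j =>
    (abs_apply_le_norm (entries b) i j).trans (le_max_right _ _)
  refine le_dimH_of_many_near (A := A') (p := u 0 / u 1) (τ := τ)
    (finite_setOf_entries_le hdisc) hb ?_ ?_ ht fun ε hε M => ?_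
  · rw [hA'ij, hA'ij, hτ']; field_simp; ring
  · rw [hA'ij, hA'ij, hτ']; field_simp; ring
  obtain ⟨n, hn, F, hFsub, hcard, hF⟩ := hdir (ε / (4 * C ^ 2 + 1)) (by positivity) ⌈M⌉₊
  refine ⟨2 ^ n, ?_, F.image fun g => a * g * b, ?_, ?_, ?_⟩
  · have h1 : (n : ℝ) ≤ 2 ^ n := by exact_mod_cast Nat.lt_two_pow_self.le
    have h2 : ((⌈M⌉₊ : ℕ) : ℝ) ≤ n := by exact_mod_cast hn
    exact (Nat.le_ceil M).trans (h2.trans h1)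
  · intro g hg
    obtain ⟨g, hgF, rfl⟩ := Finset.mem_image.1 hg
    exact Γ.mul_mem (Γ.mul_mem haΓ (hFsub hgF).1) hbΓ
  · rw [Finset.card_image_of_injective _ fun x y hxy =>
      mul_left_cancel (mul_right_cancel hxy)]
    have h1 : (((2 : ℝ) ^ n) ^ 2) ^ (t : ℝ) = ((4 : ℝ) ^ (t : ℝ)) ^ n := by
      rw [← pow_mul, mul_comm n 2, pow_mul, ← Real.rpow_natCast ((4 : ℝ) ^ (t : ℝ)),
        ← Real.rpow_mul (by norm_num), mul_comm (t : ℝ), Real.rpow_mul (by norm_num),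
        Real.rpow_natCast]
      norm_num
    rw [h1]
    exact (mul_le_mul_of_nonneg_right (Nat.le_ceil M) (by positivity)).trans hcard.le
  · intro g hg i j
    obtain ⟨g, hgF, rfl⟩ := Finset.mem_image.1 hg
    have h1 : (a * g * b) i j - 2 ^ n * A' i j =
        ∑ k, ∑ l, a i k * (g k l - 2 ^ n * A k l) * b l j := by
      simp only [hA', sl2_mul_apply, Fin.sum_univ_two]
      ring
    rw [h1]
    refine (abs_sum_mul_mul_le (a := fun k => a i k) (b := fun l => b l j) hC0 (haC i)
      (fun l => hbC l j) (hF g hgF)).trans ?_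
    have h2 : 4 * (C * (ε / (4 * C ^ 2 + 1) * 2 ^ n) * C) =
        (4 * C ^ 2 / (4 * C ^ 2 + 1)) * (ε * 2 ^ n) := by ring
    rw [h2]
    exact mul_le_of_le_one_left (by positivity) ((div_le_one (by positivity)).2 (by linarith))

/-- The real part of the image of `i`. -/
def orbitCenter (g : SL(2, ℝ)) : ℝ := (g • UpperHalfPlane.I : ℍ).re

/-- If `g` maps a point of a compact set to a bounded point, then the real parts of the image and of
`g i` differ by at most a constant multiple of `‖g‖ ^ (-2)`. -/
lemma abs_re_sub_orbitCenter_le {g : SL(2, ℝ)} {z : ℍ} {b Z W : ℝ} (hb : 0 < b)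
    (hz : ‖(z : ℂ)‖ ≤ Z) (hbz : b ≤ z.im) (hw : ‖((g • z : ℍ) : ℂ)‖ ≤ W) :
    |(g • z).re - orbitCenter g| * ‖entries g‖ ^ 2 ≤
      ((1 + W) * (1 / b + 1 + Z / b) * (Z + 1)) ^ 2 := by
  have hZ : 0 ≤ Z := (norm_nonneg _).trans hz
  have hW : 0 ≤ W := (norm_nonneg _).trans hw
  have hden : ∀ y : ℍ, ((g 1 0 : ℂ) * y + (g 1 1 : ℂ)) ≠ 0 := by
    intro y h0
    have him : g 1 0 * y.im = 0 := by simpa using congrArg Complex.im h0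
    have hre : g 1 0 * y.re + g 1 1 = 0 := by simpa using congrArg Complex.re h0
    have h1 : g 1 0 = 0 := by simpa [y.im_pos.ne'] using him
    have h2 : g 1 1 = 0 := by simpa [h1] using hre
    simpa [h1, h2] using sl2_det_eq g
  set J : ℂ := (g 1 0 : ℂ) * z + (g 1 1 : ℂ) with hJ
  set J' : ℂ := (g 1 0 : ℂ) * (UpperHalfPlane.I : ℍ) + (g 1 1 : ℂ) with hJ'
  have hJ0 : J ≠ 0 := hden z
  have hJ'0 : J' ≠ 0 := hden _
  have hNpos : 0 < ‖J‖ := norm_pos_iff.2 hJ0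
  have hN'pos : 0 < ‖J'‖ := norm_pos_iff.2 hJ'0
  have hwJ : ((g • z : ℍ) : ℂ) * J = (g 0 0 : ℂ) * z + (g 0 1 : ℂ) := by
    rw [coe_sl2_smul, div_mul_cancel₀ _ hJ0]
  have hlin : ∀ p q : ℝ, |p| * b ≤ ‖(p : ℂ) * z + q‖ ∧
      |q| ≤ ‖(p : ℂ) * z + q‖ + |p| * Z := by
    intro p q
    constructor
    · have h1 := Complex.abs_im_le_norm ((p : ℂ) * z + q)
      have h2 : ((p : ℂ) * z + q).im = p * z.im := by simp
      rw [h2, abs_mul, abs_of_pos z.im_pos] at h1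
      exact (mul_le_mul_of_nonneg_left hbz (abs_nonneg p)).trans h1
    · have h1 := norm_sub_le ((p : ℂ) * z + q) ((p : ℂ) * z)
      rw [add_sub_cancel_left, norm_mul, Complex.norm_real, Complex.norm_real, Real.norm_eq_abs,
        Real.norm_eq_abs] at h1
      exact h1.trans (by gcongr)
  set E := (1 + W) * (1 / b + 1 + Z / b) with hE
  have hZb : 0 ≤ Z / b := by positivity
  have h1b : 0 < 1 / b := by positivity
  have hbound : ∀ p q : ℝ, ∀ V, 0 ≤ V → V ≤ 1 + W → ‖(p : ℂ) * z + q‖ ≤ V * ‖J‖ →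
      |p| ≤ E * ‖J‖ ∧ |q| ≤ E * ‖J‖ := by
    intro p q V hV hVW h
    obtain ⟨h1, h2⟩ := hlin p q
    have h3 : V * ‖J‖ ≤ (1 + W) * ‖J‖ := by gcongr
    have h4 : |p| ≤ (1 + W) * ‖J‖ * (1 / b) := by
      rw [mul_one_div, le_div_iff₀ hb]; linarith
    have h5 : |p| * Z ≤ (1 + W) * ‖J‖ * (Z / b) := by
      calc |p| * Z ≤ (1 + W) * ‖J‖ * (1 / b) * Z := by gcongr
        _ = _ := by ring
    have h6 : 0 ≤ (1 + W) * ‖J‖ := by positivity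
    have h7 : E * ‖J‖ = (1 + W) * ‖J‖ * (1 / b) + (1 + W) * ‖J‖ +
      (1 + W) * ‖J‖ * (Z / b) := by rw [hE]; ring
    have h8 : 0 ≤ (1 + W) * ‖J‖ * (1 / b) := by positivity
    have h9 : 0 ≤ (1 + W) * ‖J‖ * (Z / b) := by positivity
    constructor <;> linarith
  have hE0 : 0 ≤ E := by positivity
  have hrow0 := hbound (g 0 0) (g 0 1) W hW (by linarith) (by
    rw [← hwJ, norm_mul]; gcongr)
  have hrow1 := hbound (g 1 0) (g 1 1) 1 zero_le_one (by linarith) (one_mul ‖J‖).ge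
  have hnorm : ‖entries g‖ ≤ E * ‖J‖ := by
    refine norm_le_of_abs_apply_le (by positivity) fun i j => ?_
    fin_cases i <;> fin_cases j
    exacts [hrow0.1, hrow0.2, hrow1.1, hrow1.2]
  have hJJ' : ‖J‖ ≤ (Z + 1) * ‖J'‖ := by
    have h1 : |g 1 0| ≤ ‖J'‖ := by
      have := Complex.abs_im_le_norm J'
      simpa [hJ'] using this
    have h2 : |g 1 1| ≤ ‖J'‖ := by
      have := Complex.abs_re_le_norm J'
      simpa [hJ'] using this
    calc ‖J‖ ≤ ‖(g 1 0 : ℂ) * z‖ + ‖(g 1 1 : ℂ)‖ := norm_add_le _ _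
      _ = |g 1 0| * ‖(z : ℂ)‖ + |g 1 1| := by
        rw [norm_mul, Complex.norm_real, Complex.norm_real, Real.norm_eq_abs, Real.norm_eq_abs]
      _ ≤ ‖J'‖ * Z + ‖J'‖ := by gcongr
      _ = _ := by ring
  have hdiff : |(g • z).re - orbitCenter g| * (‖J‖ * ‖J'‖) ≤ Z + 1 := by
    have h1 : (((g • z : ℍ) : ℂ) - ((g • UpperHalfPlane.I : ℍ) : ℂ)) * (J * J') =
        z - (UpperHalfPlane.I : ℍ) := by
      have hdet : ((g 0 0 : ℝ) : ℂ) * (g 1 1 : ℝ) - (g 0 1 : ℝ) * (g 1 0 : ℝ) = 1 := by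
        exact_mod_cast sl2_det_eq g
      have h2 : ((g • UpperHalfPlane.I : ℍ) : ℂ) * J' =
          (g 0 0 : ℂ) * (UpperHalfPlane.I : ℍ) + (g 0 1 : ℂ) := by
        rw [coe_sl2_smul, div_mul_cancel₀ _ hJ'0]
      linear_combination J' * hwJ - J * h2 + ((z : ℂ) - (UpperHalfPlane.I : ℍ)) * hdet
    have h2 := Complex.abs_re_le_norm
      (((g • z : ℍ) : ℂ) - ((g • UpperHalfPlane.I : ℍ) : ℂ))
    have h3 : |(g • z).re - orbitCenter g| ≤
      ‖((g • z : ℍ) : ℂ) - ((g • UpperHalfPlane.I : ℍ) : ℂ)‖ := h2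
    calc _ ≤ ‖((g • z : ℍ) : ℂ) - ((g • UpperHalfPlane.I : ℍ) : ℂ)‖ * (‖J‖ * ‖J'‖) := by gcongr
      _ = ‖(z : ℂ) - (UpperHalfPlane.I : ℍ)‖ := by rw [← h1, norm_mul, norm_mul]
      _ ≤ ‖(z : ℂ)‖ + ‖((UpperHalfPlane.I : ℍ) : ℂ)‖ := norm_sub_le _ _
      _ ≤ Z + 1 := by
        have : ‖((UpperHalfPlane.I : ℍ) : ℂ)‖ = 1 := by simp
        linarith
  calc _ ≤ |(g • z).re - orbitCenter g| * ((E * ‖J‖) * (E * ((Z + 1) * ‖J'‖))) := by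
        rw [sq]
        gcongr
        exact hnorm.trans (by gcongr)
    _ = E ^ 2 * (Z + 1) * (|(g • z).re - orbitCenter g| * (‖J‖ * ‖J'‖)) := by ring
    _ ≤ E ^ 2 * (Z + 1) * (Z + 1) := by gcongr
    _ = _ := by ring

/-- The points approximated by infinitely many orbit centres at rate `R * ‖g‖ ^ (-2)`. -/
def approxSet (Γ : Subgroup SL(2, ℝ)) (R : ℝ) : Set ℝ :=
  {x | {g : SL(2, ℝ) | g ∈ Γ ∧ |x - orbitCenter g| * ‖entries g‖ ^ 2 ≤ R}.Infinite}

lemma IsConicalLimitPoint.exists_mem_approxSet {Γ : Subgroup SL(2, ℝ)} {x : ℝ}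
    (h : IsConicalLimitPoint Γ (projPt x)) : ∃ R : ℕ, x ∈ approxSet Γ R := by
  obtain ⟨K, hK, γ, hinj, hΓ, hmeet⟩ := h
  have hne : K.Nonempty := by
    obtain ⟨_, ⟨z, hz, -⟩, -⟩ := hmeet 0
    exact ⟨z, hz⟩
  obtain ⟨Z, hZ⟩ := hK.exists_bound_of_continuousOn
    (f := fun z : ℍ => (z : ℂ)) UpperHalfPlane.continuous_coe.continuousOn
  obtain ⟨z₀, -, hz₀⟩ := hK.exists_isMinOn hne UpperHalfPlane.continuous_im.continuousOn
  obtain ⟨R, hR⟩ := exists_nat_ge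
    (((1 + (|x| + 1)) * (1 / z₀.im + 1 + Z / z₀.im) * (Z + 1)) ^ 2)
  refine ⟨R, Set.infinite_of_injective_forall_mem hinj fun k => ⟨hΓ k, ?_⟩⟩
  obtain ⟨_, ⟨z, hz, rfl⟩, hray⟩ := hmeet k
  obtain ⟨hre, him⟩ := mem_ray_projPt.1 hray
  have hW : ‖((γ k • z : ℍ) : ℂ)‖ ≤ |x| + 1 := by
    refine (Complex.norm_le_abs_re_add_abs_im _).trans (add_le_add ?_ ?_)
    · exact (congrArg abs hre).le
    · exact (abs_of_pos (γ k • z).im_pos).le.trans him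
  have h1 := abs_re_sub_orbitCenter_le z₀.im_pos (hZ z hz) (hz₀ hz) hW
  have h2 : (γ k • z).re = x := hre
  rw [h2] at h1
  exact h1.trans hR

lemma finite_shell {Γ : Subgroup SL(2, ℝ)}
    (hfin : ∀ R : ℝ, {g : SL(2, ℝ) | g ∈ Γ ∧ ∀ i j, |g i j| ≤ R}.Finite) (n : ℕ) :
    (shell Γ n).Finite :=
  (hfin (2 ^ (n + 1))).subset fun g hg =>
    ⟨hg.1, fun i j => (abs_apply_le_norm (entries g) i j).trans hg.2.2.le⟩

/-- The points of `approxSet Γ R` are covered by the intervals around the centres of the elements of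
large norm. -/
lemma exists_mem_shell_of_mem_approxSet {Γ : Subgroup SL(2, ℝ)}
    (hfin : ∀ R : ℝ, {g : SL(2, ℝ) | g ∈ Γ ∧ ∀ i j, |g i j| ≤ R}.Finite) {R x : ℝ}
    (hx : x ∈ approxSet Γ R) (m : ℕ) :
    ∃ k, ∃ g ∈ shell Γ (k + m), |x - orbitCenter g| ≤ R / 4 ^ (k + m) := by
  obtain ⟨g, ⟨hgΓ, hg⟩, hgm⟩ := (hx.sdiff (hfin (2 ^ m))).nonempty
  have hlt : 2 ^ m < ‖entries g‖ := by
    by_contra! hle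
    exact hgm ⟨hgΓ, fun i j => (abs_apply_le_norm (entries g) i j).trans hle⟩
  obtain ⟨n, hn1, hn2⟩ := exists_nat_pow_near
    ((one_le_pow₀ one_le_two : (1 : ℝ) ≤ 2 ^ m).trans hlt.le) (one_lt_two (α := ℝ))
  have hmn : m < n + 1 := (pow_lt_pow_iff_right₀ (one_lt_two (α := ℝ))).1 (hlt.trans hn2)
  refine ⟨n - m, g, ?_⟩
  rw [Nat.sub_add_cancel (by omega)]
  refine ⟨⟨hgΓ, hn1, hn2⟩, ?_⟩
  rw [le_div_iff₀ (by positivity)]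
  refine le_trans ?_ hg
  have h4 : (4 : ℝ) ^ n = (2 ^ n) ^ 2 := by rw [← pow_mul, mul_comm, pow_mul]; norm_num
  rw [h4]
  gcongr

lemma hausdorffMeasure_approxSet {Γ : Subgroup SL(2, ℝ)}
    (hfin : ∀ R : ℝ, {g : SL(2, ℝ) | g ∈ Γ ∧ ∀ i j, |g i j| ≤ R}.Finite) {t s : NNReal}
    (hts : t < s) {M : ℕ} (hM : ∀ n ≥ M, ∀ F : Finset SL(2, ℝ), (F : Set SL(2, ℝ)) ⊆ shell Γ n →
      (F.card : ℝ) ≤ M * ((4 : ℝ) ^ (t : ℝ)) ^ n) {R : ℝ} (hR : 0 ≤ R) :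
    MeasureTheory.Measure.hausdorffMeasure (s : ℝ) (approxSet Γ R) = 0 := by
  set θ : ℝ := (4 : ℝ) ^ (t : ℝ) * ((4 : ℝ) ^ (s : ℝ))⁻¹ with hθ
  have hθ0 : 0 ≤ θ := by positivity
  have hθ1 : θ < 1 := by
    rw [hθ, ← div_eq_mul_inv, div_lt_one (by positivity)]
    exact Real.rpow_lt_rpow_of_exponent_lt (by norm_num) (by exact_mod_cast hts)
  set f : ℕ → ENNReal := fun n => ENNReal.ofReal (M * (2 * R) ^ (s : ℝ) * θ ^ n) with hf
  have hfsum : ∑' n, f n ≠ ⊤ :=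
    ((summable_geometric_of_lt_one hθ0 hθ1).mul_left _).tsum_ofReal_ne_top
  have hr : Filter.Tendsto (fun n : ℕ => ENNReal.ofReal (2 * R * (4⁻¹ : ℝ) ^ n)) Filter.atTop
      (nhds 0) := by
    have := (tendsto_pow_atTop_nhds_zero_of_lt_one (by norm_num : (0 : ℝ) ≤ 4⁻¹)
      (by norm_num)).const_mul (2 * R)
    simpa using ENNReal.tendsto_ofReal this
  have hcount : ∀ n, Finite (shell Γ n) := fun n => (finite_shell hfin n).to_subtype
  have hdiam : ∀ c : ℝ, ∀ n : ℕ, Metric.ediam (Set.Icc (c - R / 4 ^ n) (c + R / 4 ^ n)) =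
      ENNReal.ofReal (2 * R * (4⁻¹ : ℝ) ^ n) := by
    intro c n
    rw [Real.ediam_Icc, inv_pow]
    congr 1
    ring
  have hcover := MeasureTheory.Measure.hausdorffMeasure_le_liminf_tsum
    (ι := fun n : ℕ => Σ k : ℕ, shell Γ (k + n)) (l := Filter.atTop) (s : ℝ) (approxSet Γ R)
    _ hr (fun n i => Set.Icc (orbitCenter (i.2 : SL(2, ℝ)) - R / 4 ^ (i.1 + n))
      (orbitCenter (i.2 : SL(2, ℝ)) + R / 4 ^ (i.1 + n)))
    (Filter.Eventually.of_forall fun n i => ?_) (Filter.Eventually.of_forall fun n x hx => ?_)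
  · refine le_antisymm (hcover.trans ?_) zero_le
    rw [← (ENNReal.tendsto_sum_nat_add f hfsum).liminf_eq]
    refine Filter.liminf_le_liminf ((Filter.eventually_ge_atTop M).mono fun n hn => ?_)
    rw [ENNReal.tsum_sigma']
    refine ENNReal.tsum_le_tsum fun k => ?_
    have hfi := Fintype.ofFinite (shell Γ (k + n))
    simp only [hdiam]
    rw [tsum_fintype, Finset.sum_const, nsmul_eq_mul,
      ENNReal.ofReal_rpow_of_nonneg (by positivity) s.coe_nonneg]
    have hcard : (Finset.card (Finset.univ : Finset (shell Γ (k + n))) : ℝ) ≤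
        M * ((4 : ℝ) ^ (t : ℝ)) ^ (k + n) := by
      have := hM (k + n) (by omega) (Finset.univ.map (Function.Embedding.subtype _))
        (by intro g hg; simpa using hg)
      rwa [Finset.card_map] at this
    rw [hf, ← ENNReal.ofReal_natCast, ← ENNReal.ofReal_mul (by positivity)]
    refine ENNReal.ofReal_le_ofReal ?_
    calc _ ≤ M * ((4 : ℝ) ^ (t : ℝ)) ^ (k + n) * (2 * R * 4⁻¹ ^ (k + n)) ^ (s : ℝ) := by gcongr
      _ = M * (2 * R) ^ (s : ℝ) * θ ^ (k + n) := by
        rw [Real.mul_rpow (by positivity) (by positivity), hθ, mul_pow,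
          ← Real.rpow_natCast (4⁻¹ : ℝ), ← Real.rpow_mul (by norm_num), mul_comm ((k + n : ℕ) : ℝ),
          Real.rpow_mul (by norm_num), Real.rpow_natCast, Real.inv_rpow (by norm_num)]
        ring
  · rw [hdiam]
    refine ENNReal.ofReal_le_ofReal ?_
    gcongr ?_ * ?_
    exact pow_le_pow_of_le_one (by norm_num) (by norm_num) (by omega)
  · obtain ⟨k, g, hg, hxg⟩ := exists_mem_shell_of_mem_approxSet hfin hx n
    refine Set.mem_iUnion.2 ⟨⟨k, g, hg⟩, ?_⟩
    have := abs_le.1 hxg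
    constructor <;> linarith

/-- The dimension of the conical limit set is at most the exponential growth rate of the shells. -/
lemma dimH_conical_le {Γ : Subgroup SL(2, ℝ)} (hdisc : DiscreteTopology Γ) {t s : NNReal}
    (hts : t < s) (h : ∃ M : ℕ, ∀ n ≥ M, ∀ F : Finset SL(2, ℝ), (F : Set SL(2, ℝ)) ⊆ shell Γ n →
      (F.card : ℝ) ≤ M * ((4 : ℝ) ^ (t : ℝ)) ^ n) :
    dimH {x : ℝ | IsConicalLimitPoint Γ (projPt x)} ≤ s := by
  obtain ⟨M, hM⟩ := h
  have hsub : {x : ℝ | IsConicalLimitPoint Γ (projPt x)} ⊆ ⋃ R : ℕ, approxSet Γ R :=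
    fun x hx => Set.mem_iUnion.2 (IsConicalLimitPoint.exists_mem_approxSet hx)
  refine (dimH_mono hsub).trans ?_
  rw [dimH_iUnion]
  refine iSup_le fun R => dimH_le_of_hausdorffMeasure_ne_top ?_
  rw [hausdorffMeasure_approxSet (finite_setOf_entries_le hdisc) hts hM R.cast_nonneg]
  exact ENNReal.zero_ne_top

lemma IsUniformConicalLimitPoint.isConicalLimitPoint {Γ : Subgroup SL(2, ℝ)} {x : ℝ}
    (h : IsUniformConicalLimitPoint Γ (projPt x)) : IsConicalLimitPoint Γ (projPt x) := by
  obtain ⟨K, hK, γ, hinj, hΓ, hcov⟩ := h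
  by_cases hS : {k | (γ k • K ∩ ray (projPt x)).Nonempty}.Infinite
  · set e := hS.natEmbedding
    exact ⟨K, hK, fun k => γ (e k), fun a b hab => e.injective (Subtype.ext (hinj hab)),
      fun k => hΓ _, fun k => (e k).2⟩
  rw [Set.not_infinite] at hS
  have hcomp : IsCompact (⋃ k ∈ {k | (γ k • K ∩ ray (projPt x)).Nonempty}, γ k • K) :=
    hS.isCompact_biUnion fun k _ => hK.smul (γ k)
  have hsub : ray (projPt x) ⊆ ⋃ k ∈ {k | (γ k • K ∩ ray (projPt x)).Nonempty}, γ k • K := by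
    intro z hz
    obtain ⟨k, hk⟩ := Set.mem_iUnion.1 (hcov hz)
    exact Set.mem_biUnion (show k ∈ {k | (γ k • K ∩ ray (projPt x)).Nonempty} from ⟨z, hk, hz⟩) hk
  have hI : (⟨⟨x, 1⟩, one_pos⟩ : ℍ) ∈ ray (projPt x) := mem_ray_projPt.2 ⟨rfl, le_rfl⟩
  obtain ⟨z₀, -, hz₀⟩ := hcomp.exists_isMinOn ⟨_, hsub hI⟩
    UpperHalfPlane.continuous_im.continuousOn
  have hpos : 0 < min 1 (z₀.im / 2) := lt_min one_pos (half_pos z₀.im_pos)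
  have hlow : (⟨⟨x, min 1 (z₀.im / 2)⟩, hpos⟩ : ℍ) ∈ ray (projPt x) :=
    mem_ray_projPt.2 ⟨rfl, min_le_left _ _⟩
  have h1 : z₀.im ≤ min 1 (z₀.im / 2) := hz₀ (hsub hlow)
  have h2 := min_le_right 1 (z₀.im / 2)
  linarith [z₀.im_pos]

/-- **Bishop–Jones (Corollary 2.5), as rephrased in the paper.** For a non-elementary discrete
purely hyperbolic subgroup of `SL(2, ℝ)`, the conical limit set and the uniform conical limit
set have the same Hausdorff dimension. -/
theorem dimH_conical_eq_dimH_uniformConical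
    (Γ : Subgroup SL(2, ℝ)) (hdisc : DiscreteTopology Γ)
    (hPH : PurelyHyperbolic Γ) (hNE : IsNonElementary Γ) :
    dimH {x : ℝ | IsConicalLimitPoint Γ (projPt x)} =
      dimH {x : ℝ | IsUniformConicalLimitPoint Γ (projPt x)} := by
  refine le_antisymm ?_ (dimH_mono fun x hx => IsUniformConicalLimitPoint.isConicalLimitPoint hx)
  by_contra! hlt
  obtain ⟨t, hUt, htC⟩ := ENNReal.lt_iff_exists_nnreal_btwn.1 hlt
  obtain ⟨s, hts, hsC⟩ := ENNReal.lt_iff_exists_nnreal_btwn.1 htC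
  have ht : 0 < t := by exact_mod_cast zero_le.trans_lt hUt
  by_cases h : ∃ M : ℕ, ∀ n ≥ M, ∀ F : Finset SL(2, ℝ), (F : Set SL(2, ℝ)) ⊆ shell Γ n →
      (F.card : ℝ) ≤ M * ((4 : ℝ) ^ (t : ℝ)) ^ n
  · exact (dimH_conical_le hdisc (by exact_mod_cast hts) h).not_gt hsC
  · exact (le_dimH_of_large_shells hdisc hPH hNE ht h).not_gt hUt

end
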